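/- arXiv:1110.5888 — 5 statements merged into one kernel-verified Lean document; each statement's English description precedes it below -/
import Mathlib

section
/- Let n ≥ 2, k ≥ 3, 0 < ε ≤ 1, let f : S_k^n → [k] be an SCF, let a ≠ b be alternatives, and let z ∈ {−1,1}^n be such that B_1(z^{a,b}) is a small fiber. Writing B = B_1(z^{a,b}), the edge boundary satisfies |∂_e(B)| ≥ (ε^3/(4 n^3 k^9)) · |B|, and the vertex boundary satisfies P(σ ∈ ∂(B)) ≥ (ε^3/(2 n^4 k^9 · k!)) · P(σ ∈ B). -/
open Finset

/-- `a` is ranked above `b` in the ranking `τ` (a ranking maps positions to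
alternatives; earlier positions are better). -/
def Above {k : ℕ} (τ : Equiv.Perm (Fin k)) (a b : Fin k) : Prop :=
  τ.symm a < τ.symm b

/-- Uniform probability of an event over a finite type. -/
noncomputable def prob {Ω : Type*} [Fintype Ω] (p : Ω → Prop) : ℝ := by
  classical exact ((Finset.univ.filter p).card : ℝ) / (Fintype.card Ω : ℝ)

/-- Number of elements satisfying an event, as a real number. -/
noncomputable def count {Ω : Type*} [Fintype Ω] (p : Ω → Prop) : ℝ := by
  classical exact ((Finset.univ.filter p).card : ℝ)

/-- A ranking profile for `n` voters and `k` alternatives. -/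
abbrev Profile (n k : ℕ) := Fin n → Equiv.Perm (Fin k)

/-- `(σ, σ')` is a manipulation pair for `f` at coordinate `i`: they differ exactly
in coordinate `i` and voter `i` truly prefers `f σ'` to `f σ`. -/
def IsManipPairAt {n k : ℕ} (f : Profile n k → Fin k) (σ σ' : Profile n k) (i : Fin n) : Prop :=
  σ i ≠ σ' i ∧ (∀ j, j ≠ i → σ j = σ' j) ∧ Above (σ i) (f σ') (f σ)

/-- `σ` is a manipulation point of `f`, i.e. `σ ∈ M(f)`. -/
def IsManipPoint {n k : ℕ} (f : Profile n k → Fin k) (σ : Profile n k) : Prop :=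
  ∃ σ' i, IsManipPairAt f σ σ' i

/-- `τ` and `τ'` agree outside a block of at most `r` consecutive positions. -/
def AgreeOutsideBlock {k : ℕ} (r : ℕ) (τ τ' : Equiv.Perm (Fin k)) : Prop :=
  ∃ l : ℕ, ∀ p : Fin k, ((p : ℕ) < l ∨ l + r ≤ (p : ℕ)) → τ p = τ' p

/-- `σ` is an `r`-manipulation point of `f`, i.e. `σ ∈ M_r(f)`. -/
def IsManipPointR {n k : ℕ} (r : ℕ) (f : Profile n k → Fin k) (σ : Profile n k) : Prop :=
  ∃ σ' i, IsManipPairAt f σ σ' i ∧ AgreeOutsideBlock r (σ i) (σ' i)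

/-- `f` always elects the top alternative of `H` according to voter `i`. -/
def IsTopOn {n k : ℕ} (f : Profile n k → Fin k) (i : Fin n) (H : Finset (Fin k)) : Prop :=
  ∀ σ, f σ ∈ H ∧ ∀ b ∈ H, b ≠ f σ → Above (σ i) (f σ) b

/-- `f` takes exactly two values. -/
def TakesExactlyTwoValues {n k : ℕ} (f : Profile n k → Fin k) : Prop :=
  ∃ a b : Fin k, a ≠ b ∧ (∀ σ, f σ = a ∨ f σ = b) ∧ (∃ σ, f σ = a) ∧ (∃ σ, f σ = b)

/-- `f` is monotone: whenever `σ, σ'` differ in exactly one coordinate `i` and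
`f σ ≠ f σ'`, voter `i` ranks `f σ'` above `f σ` in `σ' i`. -/
def IsMonotone {n k : ℕ} (f : Profile n k → Fin k) : Prop :=
  ∀ (σ σ' : Profile n k) (i : Fin n),
    σ i ≠ σ' i → (∀ j, j ≠ i → σ j = σ' j) → f σ ≠ f σ' → Above (σ' i) (f σ') (f σ)

/-- The family `NONMANIP(n,k)` of nonmanipulable social choice functions. -/
def InNonManip {n k : ℕ} (f : Profile n k → Fin k) : Prop :=
  (∃ (i : Fin n) (H : Finset (Fin k)), H.Nonempty ∧ IsTopOn f i H) ∨
  (TakesExactlyTwoValues f ∧ IsMonotone f)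

/-- The family `NONMANIP-bar`: functions depending on one coordinate only,
or taking at most two values. -/
def InNonManipBar {n k : ℕ} (f : Profile n k → Fin k) : Prop :=
  (∃ i : Fin n, ∀ σ σ' : Profile n k, σ i = σ' i → f σ = f σ') ∨
  (∃ a b : Fin k, ∀ σ, f σ = a ∨ f σ = b)

/-- `σ` lies in the fiber `F(z^{a,b})`: `z i = true` iff voter `i` prefers `a` to `b`. -/
def InFiber {n k : ℕ} (a b : Fin k) (z : Fin n → Bool) (σ : Profile n k) : Prop :=
  ∀ i, Above (σ i) a b ↔ z i = true

/-- `σ` is on the boundary `B_i^{a,b}(f)`: `f σ = a` and some `σ'` differing from `σ`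
only in coordinate `i` has `f σ' = b`. -/
def OnBoundaryB {n k : ℕ} (f : Profile n k → Fin k) (i : Fin n) (a b : Fin k)
    (σ : Profile n k) : Prop :=
  f σ = a ∧ ∃ σ' : Profile n k, σ i ≠ σ' i ∧ (∀ j, j ≠ i → σ j = σ' j) ∧ f σ' = b

/-- `σ ∈ B_i(z^{a,b})`. -/
def InBFiber {n k : ℕ} (f : Profile n k → Fin k) (i : Fin n) (a b : Fin k)
    (z : Fin n → Bool) (σ : Profile n k) : Prop :=
  InFiber a b z σ ∧ OnBoundaryB f i a b σ

/-- The fiber `B_i(z^{a,b})` is large (for the parameter `ε`):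
`P(σ ∈ B_i(z^{a,b}) | σ ∈ F(z^{a,b})) ≥ 1 - ε^3/(4 n^3 k^9)`. -/
def IsLargeFiber {n k : ℕ} (f : Profile n k → Fin k) (ε : ℝ) (i : Fin n) (a b : Fin k)
    (z : Fin n → Bool) : Prop :=
  1 - ε ^ 3 / (4 * (n : ℝ) ^ 3 * (k : ℝ) ^ 9) ≤
    prob (fun σ : Profile n k => InBFiber f i a b z σ) /
      prob (fun σ : Profile n k => InFiber a b z σ)

/-- `σ ∈ Lg(B_i^{a,b})`, the union of the large fibers. -/
def InLg {n k : ℕ} (f : Profile n k → Fin k) (ε : ℝ) (i : Fin n) (a b : Fin k)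
    (σ : Profile n k) : Prop :=
  ∃ z, IsLargeFiber f ε i a b z ∧ InBFiber f i a b z σ

/-- `σ ∈ Sm(B_i^{a,b})`, the union of the small fibers. -/
def InSm {n k : ℕ} (f : Profile n k → Fin k) (ε : ℝ) (i : Fin n) (a b : Fin k)
    (σ : Profile n k) : Prop :=
  ∃ z, ¬ IsLargeFiber f ε i a b z ∧ InBFiber f i a b z σ

/-- Two profiles differ in exactly one coordinate. -/
def AdjOneCoord {n k : ℕ} (σ π : Profile n k) : Prop :=
  ∃ i, σ i ≠ π i ∧ ∀ j, j ≠ i → σ j = π j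

/-- `σ` belongs to the vertex boundary `∂(B_i(z^{a,b}))` of `B_i(z^{a,b})` inside the
fiber `F(z^{a,b})`. -/
def InFiberBdry {n k : ℕ} (f : Profile n k → Fin k) (i : Fin n) (a b : Fin k)
    (z : Fin n → Bool) (σ : Profile n k) : Prop :=
  InBFiber f i a b z σ ∧
    ∃ π, AdjOneCoord σ π ∧ InFiber a b z π ∧ ¬ InBFiber f i a b z π

/-- `σ₋ᵢ ∈ D_i(a,b)`: fixing all coordinates except `i` according to `σ`, the induced
one-voter SCF equals `top_H` for some `H ⊇ {a,b}` with `|H| ≥ 3`. -/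
def InD1 {n k : ℕ} (f : Profile n k → Fin k) (i : Fin n) (a b : Fin k)
    (σ : Profile n k) : Prop :=
  ∃ H : Finset (Fin k), a ∈ H ∧ b ∈ H ∧ 3 ≤ H.card ∧
    ∀ τ : Equiv.Perm (Fin k),
      f (Function.update σ i τ) ∈ H ∧
        ∀ c ∈ H, c ≠ f (Function.update σ i τ) → Above τ (f (Function.update σ i τ)) c

/-- Hybrid of `x` and `y`: coordinates below `j` come from `y`, the others from `x`. -/
def hyb {n : ℕ} {α : Type*} (j : ℕ) (x y : Fin n → α) : Fin n → α :=
  fun i => if i.val < j then y i else x i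

theorem hyb_hyb_left {n : ℕ} {α : Type*} (j : ℕ) (x y : Fin n → α) :
    hyb j (hyb j x y) (hyb j y x) = x := by
  funext i; simp only [hyb]; split_ifs <;> rfl

theorem hyb_hyb_right {n : ℕ} {α : Type*} (j : ℕ) (x y : Fin n → α) :
    hyb j (hyb j y x) (hyb j x y) = y := by
  funext i; simp only [hyb]; split_ifs <;> rfl

theorem hyb_agree {n : ℕ} {α : Type*} (j : Fin n) (x y : Fin n → α) (i : Fin n) (h : i ≠ j) :
    hyb j.val x y i = hyb (j.val + 1) x y i := by
  have h' : i.val ≠ j.val := fun e => h (Fin.ext e)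
  have : (i.val < j.val) ↔ (i.val < j.val + 1) := by omega
  simp only [hyb, this]

theorem hyb_cross {n : ℕ} {α : Type*} (B : (Fin n → α) → Prop) (x y : Fin n → α)
    (hx : B x) (hy : ¬ B y) : ∃ j : Fin n, B (hyb j.val x y) ∧ ¬ B (hyb (j.val + 1) x y) := by
  by_contra hcon
  push Not at hcon
  have key : ∀ j : ℕ, j ≤ n → B (hyb j x y) := by
    intro j
    induction j with
    | zero => 
      intro _
      have e : hyb 0 x y = x := by funext i; simp [hyb]
      rwa [e]
    | succ j ih => intro hj; exact hcon ⟨j, hj⟩ (ih (by omega))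
  apply hy
  have := key n le_rfl
  have e : hyb n x y = y := by funext i; simp [hyb]
  rwa [e] at this

theorem hyb_ne {n : ℕ} {α : Type*} (B : (Fin n → α) → Prop) (x y : Fin n → α) (j : Fin n)
    (h : B (hyb j.val x y) ∧ ¬ B (hyb (j.val + 1) x y)) :
    hyb j.val x y j ≠ hyb (j.val + 1) x y j := by
  intro e
  apply h.2
  have : hyb j.val x y = hyb (j.val + 1) x y := by
    funext i
    by_cases hi : i = j
    · rw [hi]; exact e
    · exact hyb_agree j x y i hi
  rw [← this]; exact h.1

open Classical in
theorem iso_aux {n k : ℕ} (F B : Profile n k → Prop) (hBF : ∀ σ, B σ → F σ)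
    (hF : ∀ j x y, F x → F y → F (hyb j x y)) :
    (#{σ | B σ} * #{σ | F σ ∧ ¬ B σ} ≤
      #{p : Profile n k × Profile n k | B p.1 ∧ F p.2 ∧ ¬ B p.2 ∧ AdjOneCoord p.1 p.2} *
        #{σ | F σ}) ∧
    (#{σ | B σ} * #{σ | F σ ∧ ¬ B σ} ≤
      #{σ | B σ ∧ ∃ π, AdjOneCoord σ π ∧ F π ∧ ¬ B π} * #(range n) * #{σ | F σ}) := by
  have hc : ∀ p : Profile n k × Profile n k, ∃ j : ℕ, B p.1 → ¬ B p.2 →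
      ∃ h : j < n, B (hyb j p.1 p.2) ∧ ¬ B (hyb (j + 1) p.1 p.2) := by
    intro p
    by_cases h : B p.1 ∧ ¬ B p.2
    · obtain ⟨j, hj⟩ := hyb_cross B p.1 p.2 h.1 h.2
      exact ⟨j.val, fun _ _ => ⟨j.isLt, hj⟩⟩
    · exact ⟨0, fun h1 h2 => absurd ⟨h1, h2⟩ h⟩
  choose J hJ using hc
  have hadj : ∀ p : Profile n k × Profile n k, B p.1 → ¬ B p.2 →
      AdjOneCoord (hyb (J p) p.1 p.2) (hyb (J p + 1) p.1 p.2) := by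
    intro p h1 h2
    obtain ⟨hlt, hj⟩ := hJ p h1 h2
    exact ⟨⟨J p, hlt⟩, hyb_ne B p.1 p.2 ⟨J p, hlt⟩ hj,
      fun i hi => hyb_agree ⟨J p, hlt⟩ p.1 p.2 i hi⟩
  have hinj : ∀ p q : Profile n k × Profile n k, J p = J q →
      hyb (J p) p.1 p.2 = hyb (J q) q.1 q.2 → hyb (J p) p.2 p.1 = hyb (J q) q.2 q.1 →
      p = q := by
    intro p q e h1 h2
    apply Prod.ext
    · rw [← hyb_hyb_left (J p) p.1 p.2, h1, h2, e, hyb_hyb_left]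
    · rw [← hyb_hyb_right (J p) p.1 p.2, h1, h2, e, hyb_hyb_right]
  constructor
  · rw [← card_product, ← card_product]
    apply card_le_card_of_injOn
      (fun p => ((hyb (J p) p.1 p.2, hyb (J p + 1) p.1 p.2), hyb (J p) p.2 p.1))
    · intro p hp
      simp only [coe_product, Set.mem_prod, mem_coe, mem_filter, mem_univ, true_and] at hp ⊢
      obtain ⟨h1, h2, h3⟩ := hp
      obtain ⟨hlt, hj⟩ := hJ p h1 h3
      exact ⟨⟨hj.1, hF _ _ _ (hBF _ h1) h2, hj.2, hadj p h1 h3⟩, hF _ _ _ h2 (hBF _ h1)⟩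
    · intro p hp q hq hpq
      simp only [coe_product, Set.mem_prod, mem_coe, mem_filter, mem_univ, true_and] at hp hq
      simp only [Prod.mk.injEq] at hpq
      obtain ⟨⟨e1, e2⟩, e3⟩ := hpq
      refine hinj p q ?_ e1 e3
      obtain ⟨hltp, hjp⟩ := hJ p hp.1 hp.2.2
      obtain ⟨hltq, hjq⟩ := hJ q hq.1 hq.2.2
      by_contra hne
      apply hyb_ne B p.1 p.2 ⟨J p, hltp⟩ hjp
      have := hyb_agree ⟨J q, hltq⟩ q.1 q.2 ⟨J p, hltp⟩ (fun e => hne (congrArg Fin.val e))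
      simp only at this ⊢
      rw [e1, e2, this]
  · rw [← card_product, ← card_product, ← card_product]
    apply card_le_card_of_injOn
      (fun p => ((hyb (J p) p.1 p.2, J p), hyb (J p) p.2 p.1))
    · intro p hp
      simp only [coe_product, Set.mem_prod, mem_coe, mem_filter, mem_univ, true_and,
        mem_range] at hp ⊢
      obtain ⟨h1, h2, h3⟩ := hp
      obtain ⟨hlt, hj⟩ := hJ p h1 h3
      exact ⟨⟨⟨hj.1, _, hadj p h1 h3, hF _ _ _ (hBF _ h1) h2, hj.2⟩, hlt⟩,
        hF _ _ _ h2 (hBF _ h1)⟩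
    · intro p hp q hq hpq
      simp only [Prod.mk.injEq] at hpq
      obtain ⟨⟨e1, e2⟩, e3⟩ := hpq
      exact hinj p q e2 e1 e3

theorem real_aux {c B C E F : ℝ} (hB : 0 ≤ B) (hC : 0 ≤ C) (hE : 0 ≤ E) (hF : B + C = F)
    (h : B * C ≤ E * F) (hl : B / F < 1 - c) : c * B ≤ E := by
  rcases eq_or_lt_of_le (show 0 ≤ F by linarith) with h0 | h0
  · have : B = 0 := by linarith
    rw [this]; simpa using hE
  · rw [div_lt_iff₀ h0] at hl
    have h1 : c * F ≤ C := by linarith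
    have h2 := mul_le_mul_of_nonneg_left h1 hB
    by_contra hcon
    push Not at hcon
    have := mul_lt_mul_of_pos_right hcon h0
    linarith

theorem stmt7 (n k : ℕ) (hn : 2 ≤ n) (hk : 3 ≤ k)
    (ε : ℝ) (hε0 : 0 < ε) (hε1 : ε ≤ 1)
    (f : Profile n k → Fin k) (a b : Fin k) (hab : a ≠ b)
    (z : Fin n → Bool)
    (hz : ¬ IsLargeFiber f ε ⟨0, by omega⟩ a b z) :
    (ε ^ 3 / (4 * (n : ℝ) ^ 3 * (k : ℝ) ^ 9)) *
        count (fun σ : Profile n k => InBFiber f ⟨0, by omega⟩ a b z σ) ≤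
      count (fun p : Profile n k × Profile n k =>
        InBFiber f ⟨0, by omega⟩ a b z p.1 ∧ InFiber a b z p.2 ∧
          ¬ InBFiber f ⟨0, by omega⟩ a b z p.2 ∧ AdjOneCoord p.1 p.2) ∧
    (ε ^ 3 / (2 * (n : ℝ) ^ 4 * (k : ℝ) ^ 9 * (Nat.factorial k : ℝ))) *
        prob (fun σ : Profile n k => InBFiber f ⟨0, by omega⟩ a b z σ) ≤
      prob (fun σ : Profile n k => InFiberBdry f ⟨0, by omega⟩ a b z σ) := by
  classical
  set i0 : Fin n := ⟨0, by omega⟩ with hi0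
  obtain ⟨h1, h2⟩ := iso_aux (InFiber a b z) (InBFiber f i0 a b z) (fun σ h => h.1)
    (by
      intro j x y hx hy i
      simp only [hyb]
      split_ifs
      · exact hy i
      · exact hx i)
  have hbd : #{σ | InFiberBdry f i0 a b z σ} = #{σ | InBFiber f i0 a b z σ ∧
      ∃ π, AdjOneCoord σ π ∧ InFiber a b z π ∧ ¬ InBFiber f i0 a b z π} := by
    congr 1
    ext σ
    rw [mem_filter, mem_filter]
    exact Iff.rfl
  rw [← hbd, card_range] at h2
  have hsplit : #{σ | InBFiber f i0 a b z σ} + #{σ | InFiber a b z σ ∧ ¬ InBFiber f i0 a b z σ}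
      = #{σ | InFiber a b z σ} := by
    rw [← card_filter_add_card_filter_not (s := ({σ | InFiber a b z σ} : Finset (Profile n k)))
      (InBFiber f i0 a b z), filter_filter, filter_filter]
    congr 2
    ext σ
    simp only [mem_filter, mem_univ, true_and]
    exact ⟨fun h => ⟨h.1, h⟩, fun h => h.2⟩
  have hN : (0 : ℝ) < Fintype.card (Profile n k) := by
    exact_mod_cast Fintype.card_pos
  have hl : (#{σ | InBFiber f i0 a b z σ} : ℝ) / (#{σ | InFiber a b z σ} : ℝ)
      < 1 - ε ^ 3 / (4 * (n : ℝ) ^ 3 * (k : ℝ) ^ 9) := by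
    unfold IsLargeFiber prob at hz
    rw [div_div_div_cancel_right₀ hN.ne'] at hz
    convert not_le.mp hz
  have hsplit' : (#{σ | InBFiber f i0 a b z σ} : ℝ)
      + (#{σ | InFiber a b z σ ∧ ¬ InBFiber f i0 a b z σ} : ℝ)
      = (#{σ | InFiber a b z σ} : ℝ) := by exact_mod_cast hsplit
  have hn0 : (0 : ℝ) < n := by exact_mod_cast (by omega : 0 < n)
  have hk0 : (0 : ℝ) < k := by exact_mod_cast (by omega : 0 < k)
  constructor
  · have := real_aux (E := (#{p : Profile n k × Profile n k | InBFiber f i0 a b z p.1 ∧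
        InFiber a b z p.2 ∧ ¬ InBFiber f i0 a b z p.2 ∧ AdjOneCoord p.1 p.2} : ℝ))
      (Nat.cast_nonneg _) (Nat.cast_nonneg _) (Nat.cast_nonneg _) hsplit'
      (by exact_mod_cast h1) hl
    unfold count
    convert this
  · have := real_aux (E := (#{σ | InFiberBdry f i0 a b z σ} : ℝ) * n)
      (Nat.cast_nonneg _) (Nat.cast_nonneg _) (by positivity) hsplit'
      (by exact_mod_cast h2) hl
    have hfac : (2 : ℝ) ≤ (Nat.factorial k : ℝ) := by
      have := Nat.self_le_factorial k
      exact_mod_cast (by omega : 2 ≤ Nat.factorial k)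
    have hcoef : ε ^ 3 / (2 * (n : ℝ) ^ 4 * (k : ℝ) ^ 9 * (Nat.factorial k : ℝ)) ≤
        ε ^ 3 / (4 * (n : ℝ) ^ 3 * (k : ℝ) ^ 9) / n := by
      rw [div_div]
      apply div_le_div_of_nonneg_left (by positivity) (by positivity)
      have : (0 : ℝ) ≤ (n : ℝ) ^ 4 * (k : ℝ) ^ 9 := by positivity
      nlinarith [mul_le_mul_of_nonneg_left hfac this]
    have hfin : ε ^ 3 / (2 * (n : ℝ) ^ 4 * (k : ℝ) ^ 9 * (Nat.factorial k : ℝ)) *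
        (#{σ | InBFiber f i0 a b z σ} : ℝ) ≤ (#{σ | InFiberBdry f i0 a b z σ} : ℝ) := by
      refine (mul_le_mul_of_nonneg_right hcoef (Nat.cast_nonneg _)).trans ?_
      rw [div_mul_eq_mul_div, div_le_iff₀ hn0]
      exact this
    unfold prob
    rw [← mul_div_assoc]
    apply div_le_div_of_nonneg_right _ hN.le
    convert hfin
end

section
/- Let n ≥ 2, k ≥ 3, 0 < ε ≤ 1, let f : S_k^n → [k] be an SCF, and let a ≠ b be alternatives. If P(σ ∈ Sm(B_1^{a,b})) ≥ ε/(n k^3), then P(σ ∈ ∪_{z ∈ {−1,1}^n} ∂(B_1(z^{a,b}))) ≥ ε^4 / (2 n^5 k^12 · k!). -/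
open Finset

/-- Vertex isoperimetry in a product fiber, by canonical paths. -/
theorem iso_aux_s8 {n k : ℕ} (Q : Fin n → Equiv.Perm (Fin k) → Prop)
    (F A D : Finset (Profile n k)) (hF : ∀ σ, σ ∈ F ↔ ∀ i, Q i (σ i)) (hA : A ⊆ F)
    (hD : ∀ σ ∈ A, ∀ π ∈ F, π ∉ A → AdjOneCoord σ π → σ ∈ D) :
    A.card * (F \ A).card ≤ n * (D.card * F.card) := by
  classical
  let hyb : ℕ → Profile n k → Profile n k → Profile n k :=
    fun i x y j => if j.val < i then y j else x j
  have hybF : ∀ i x y, x ∈ F → y ∈ F → hyb i x y ∈ F := by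
    intro i x y hx hy
    rw [hF] at *
    intro j
    simp only [hyb]
    split_ifs
    · exact hy j
    · exact hx j
  have ex : ∀ p : Profile n k × Profile n k, p ∈ A ×ˢ (F \ A) →
      ∃ i : ℕ, i < n ∧ hyb i p.1 p.2 ∈ A ∧ hyb (i + 1) p.1 p.2 ∉ A := by
    intro p hp
    simp only [Finset.mem_product, Finset.mem_sdiff] at hp
    by_contra hcon
    push Not at hcon
    have hall : ∀ m : ℕ, m ≤ n → hyb m p.1 p.2 ∈ A := by
      intro m
      induction m with
      | zero => intro _; simpa [hyb] using hp.1
      | succ m ih => intro hm; exact hcon m hm (ih (by omega))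
    have := hall n le_rfl
    simp only [hyb, Fin.is_lt, if_true] at this
    exact hp.2.2 this
  choose! c hc0 hc1 hc2 using ex
  have key : (A ×ˢ (F \ A)).card ≤ ((Finset.range n) ×ˢ (D ×ˢ F)).card := by
    apply Finset.card_le_card_of_injOn
      (fun p => (c p, hyb (c p) p.1 p.2, hyb (c p) p.2 p.1))
    · intro p hp
      have hp' := hp
      simp only [Finset.mem_coe, Finset.mem_product, Finset.mem_sdiff] at hp'
      have hx := hA hp'.1
      simp only [Finset.mem_coe, Finset.mem_product, Finset.mem_range]
      refine ⟨hc0 p hp, ?_, hybF _ _ _ hp'.2.1 hx⟩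
      refine hD _ (hc1 p hp) _ (hybF (c p + 1) _ _ hx hp'.2.1) (hc2 p hp) ?_
      have hag : ∀ j : Fin n, j ≠ ⟨c p, hc0 p hp⟩ → hyb (c p) p.1 p.2 j = hyb (c p + 1) p.1 p.2 j := by
        intro j hj
        have : j.val ≠ c p := fun h => hj (Fin.ext h)
        simp only [hyb]
        by_cases h1 : j.val < c p
        · rw [if_pos h1, if_pos (by omega)]
        · rw [if_neg h1, if_neg (by omega)]
      refine ⟨⟨c p, hc0 p hp⟩, ?_, hag⟩
      intro he
      apply hc2 p hp
      have : hyb (c p) p.1 p.2 = hyb (c p + 1) p.1 p.2 := by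
        funext j
        by_cases hj : j = ⟨c p, hc0 p hp⟩
        · rw [hj]; exact he
        · exact hag j hj
      rw [← this]
      exact hc1 p hp
    · intro p _ q _ hpq
      simp only [Prod.mk.injEq] at hpq
      obtain ⟨h1, h2, h3⟩ := hpq
      rw [h1] at h2 h3
      refine Prod.ext ?_ ?_ <;> funext j
      · have e2 := congrFun h2 j
        have e3 := congrFun h3 j
        simp only [hyb] at e2 e3
        split_ifs at e2 e3 <;> assumption
      · have e2 := congrFun h2 j
        have e3 := congrFun h3 j
        simp only [hyb] at e2 e3
        split_ifs at e2 e3 <;> assumption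
  simpa [Finset.card_product] using key

theorem fiber_unique {n k : ℕ} {a b : Fin k} {z w : Fin n → Bool} {σ : Profile n k}
    (h1 : InFiber a b z σ) (h2 : InFiber a b w σ) : z = w := by
  funext i
  have := (h1 i).symm.trans (h2 i)
  exact Bool.eq_iff_iff.mpr this

open Classical in
theorem small_fiber {n k : ℕ} (f : Profile n k → Fin k) (ε : ℝ) (hγ : 0 < ε ^ 3 / (4 * (n : ℝ) ^ 3 * (k : ℝ) ^ 9))
    (i : Fin n) (a b : Fin k) (z : Fin n → Bool) (hs : ¬ IsLargeFiber f ε i a b z) :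
    (ε ^ 3 / (4 * (n : ℝ) ^ 3 * (k : ℝ) ^ 9)) *
      ((Finset.univ.filter (fun σ : Profile n k => InBFiber f i a b z σ)).card : ℝ) ≤
    n * ((Finset.univ.filter (fun σ : Profile n k => InFiberBdry f i a b z σ)).card : ℝ) := by
  set γ := ε ^ 3 / (4 * (n : ℝ) ^ 3 * (k : ℝ) ^ 9) with hγdef
  have hT : (0 : ℝ) < Fintype.card (Profile n k) := by
    exact_mod_cast Fintype.card_pos
  unfold IsLargeFiber prob at hs
  rw [div_div_div_cancel_right₀ hT.ne', ← hγdef] at hs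
  push Not at hs
  set A := Finset.univ.filter (fun σ : Profile n k => InBFiber f i a b z σ) with hA
  set F := Finset.univ.filter (fun σ : Profile n k => InFiber a b z σ) with hF
  set D := Finset.univ.filter (fun σ : Profile n k => InFiberBdry f i a b z σ) with hD
  have hAF : A ⊆ F := by
    intro σ h
    simp only [hA, hF, Finset.mem_filter, Finset.mem_univ, true_and] at *
    exact h.1
  have iso := iso_aux_s8 (fun i τ => (Above τ a b ↔ z i = true)) F A D
    (by intro σ; simp only [hF, Finset.mem_filter, Finset.mem_univ, true_and]; rfl) hAF
    (by
      intro σ h1 π h2 h3 h4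
      simp only [hA, hF, hD, Finset.mem_filter, Finset.mem_univ, true_and] at *
      exact ⟨h1, π, h4, h2, h3⟩)
  have isoR : (A.card : ℝ) * ((F \ A).card : ℝ) ≤ n * (D.card * F.card) := by
    exact_mod_cast iso
  have hsub : ((F \ A).card : ℝ) = F.card - A.card := by
    rw [Finset.card_sdiff_of_subset hAF, Nat.cast_sub (Finset.card_le_card hAF)]
  rw [hsub] at isoR
  rcases Nat.eq_zero_or_pos F.card with h0 | h0
  · have : A.card = 0 := by
      have := Finset.card_le_card hAF
      omega
    rw [this]
    simp only [Nat.cast_zero, mul_zero]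
    positivity
  · have hFp : (0 : ℝ) < F.card := by exact_mod_cast h0
    rw [div_lt_iff₀ hFp] at hs
    have hAn : (0 : ℝ) ≤ A.card := Nat.cast_nonneg _
    have h5 : (A.card : ℝ) * (γ * F.card) ≤ A.card * (F.card - A.card) :=
      mul_le_mul_of_nonneg_left (by linarith) hAn
    refine le_of_mul_le_mul_right ?_ hFp
    linarith

theorem stmt8 (n k : ℕ) (hn : 2 ≤ n) (hk : 3 ≤ k)
    (ε : ℝ) (hε0 : 0 < ε) (hε1 : ε ≤ 1)
    (f : Profile n k → Fin k) (a b : Fin k) (hab : a ≠ b)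
    (h : ε / ((n : ℝ) * (k : ℝ) ^ 3) ≤
      prob (fun σ : Profile n k => InSm f ε ⟨0, by omega⟩ a b σ)) :
    ε ^ 4 / (2 * (n : ℝ) ^ 5 * (k : ℝ) ^ 12 * (Nat.factorial k : ℝ)) ≤
      prob (fun σ : Profile n k =>
        ∃ z : Fin n → Bool, InFiberBdry f ⟨0, by omega⟩ a b z σ) := by
  classical
  have hnp : (0 : ℝ) < n := by exact_mod_cast (by omega : 0 < n)
  have hkp : (0 : ℝ) < k := by exact_mod_cast (by omega : 0 < k)
  have hγ : 0 < ε ^ 3 / (4 * (n : ℝ) ^ 3 * (k : ℝ) ^ 9) := by positivity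
  have hT : (0 : ℝ) < Fintype.card (Profile n k) := by
    exact_mod_cast Fintype.card_pos
  have hfac : (2 : ℝ) ≤ (Nat.factorial k : ℝ) := by
    have : k ≤ Nat.factorial k := Nat.self_le_factorial k
    exact_mod_cast (by omega : 2 ≤ Nat.factorial k)
  unfold prob at h ⊢
  generalize hi : (⟨0, by omega⟩ : Fin n) = i at h ⊢
  rw [le_div_iff₀ hT] at h ⊢
  set Z := Finset.univ.filter (fun z : Fin n → Bool => ¬ IsLargeFiber f ε i a b z) with hZ
  have up : ((Finset.univ.filter (fun σ : Profile n k => InSm f ε i a b σ)).card : ℝ) ≤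
      ∑ z ∈ Z, ((Finset.univ.filter (fun σ : Profile n k => InBFiber f i a b z σ)).card : ℝ) := by
    have h1 : Finset.univ.filter (fun σ : Profile n k => InSm f ε i a b σ) ⊆
        Z.biUnion (fun z => Finset.univ.filter (fun σ : Profile n k => InBFiber f i a b z σ)) := by
      intro σ hσ
      simp only [hZ, Finset.mem_biUnion, Finset.mem_filter, Finset.mem_univ, true_and] at hσ ⊢
      exact hσ
    exact_mod_cast (Finset.card_le_card h1).trans Finset.card_biUnion_le
  have lo : ∑ z ∈ Z, ((Finset.univ.filter (fun σ : Profile n k => InFiberBdry f i a b z σ)).card : ℝ)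
      ≤ ((Finset.univ.filter (fun σ : Profile n k => ∃ z : Fin n → Bool, InFiberBdry f i a b z σ)).card : ℝ) := by
    have h1 : Z.biUnion (fun z => Finset.univ.filter (fun σ : Profile n k => InFiberBdry f i a b z σ)) ⊆
        Finset.univ.filter (fun σ : Profile n k => ∃ z : Fin n → Bool, InFiberBdry f i a b z σ) := by
      intro σ hσ
      simp only [Finset.mem_biUnion, Finset.mem_filter, Finset.mem_univ, true_and] at hσ ⊢
      obtain ⟨z, _, hz⟩ := hσ
      exact ⟨z, hz⟩
    have h2 := Finset.card_le_card h1
    rw [Finset.card_biUnion] at h2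
    · exact_mod_cast h2
    · intro z _ w _ hzw
      refine Finset.disjoint_left.mpr ?_
      intro σ h3 h4
      simp only [Finset.mem_filter, Finset.mem_univ, true_and] at h3 h4
      exact hzw (fiber_unique h3.1.1 h4.1.1)
  have mid : (ε ^ 3 / (4 * (n : ℝ) ^ 3 * (k : ℝ) ^ 9)) *
      ∑ z ∈ Z, ((Finset.univ.filter (fun σ : Profile n k => InBFiber f i a b z σ)).card : ℝ) ≤
      n * ∑ z ∈ Z, ((Finset.univ.filter (fun σ : Profile n k => InFiberBdry f i a b z σ)).card : ℝ) := by
    rw [Finset.mul_sum, Finset.mul_sum]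
    apply Finset.sum_le_sum
    intro z hz
    exact small_fiber f ε hγ i a b z (by simpa [hZ] using hz)
  have h6 := mul_le_mul_of_nonneg_left (h.trans up) hγ.le
  have h7 := (h6.trans mid).trans (mul_le_mul_of_nonneg_left lo hnp.le)
  set T : ℝ := (Fintype.card (Profile n k) : ℝ) with hTdef
  have h8 : ε ^ 4 / (2 * (n : ℝ) ^ 5 * (k : ℝ) ^ 12 * (Nat.factorial k : ℝ)) ≤
      ε ^ 4 / (2 * (n : ℝ) ^ 5 * (k : ℝ) ^ 12 * 2) := by
    gcongr
  have h9 : n * (ε ^ 4 / (2 * (n : ℝ) ^ 5 * (k : ℝ) ^ 12 * 2) * T) =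
      ε ^ 3 / (4 * (n : ℝ) ^ 3 * (k : ℝ) ^ 9) * (ε / ((n : ℝ) * (k : ℝ) ^ 3) * T) := by
    field_simp
    ring
  rw [← h9] at h7
  have h10 := le_of_mul_le_mul_left h7 hnp
  refine (mul_le_mul_of_nonneg_right h8 hT.le).trans (h10.trans (le_of_eq ?_))
  congr
end

section
/- Let n ≥ 2, k ≥ 3, let f : S_k^n → [k] be an SCF, and let a ≠ b be alternatives. Suppose the ranking profile σ satisfies σ ∈ ∂(B_1(z^{a,b})) for some z ∈ {−1,1}^n. Then either σ_{−1} ∈ D_1(a,b), or there exists a manipulation point σ̂ ∈ M(f) that agrees with σ in all coordinates except possibly coordinate 1 and at most one other coordinate. -/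
open Finset

theorem exists_top_two {k : ℕ} (hk : 3 ≤ k) (x y : Fin k) (hxy : x ≠ y) :
    ∃ τ : Equiv.Perm (Fin k), (∀ w, w ≠ x → Above τ x w) ∧
      (∀ w, w ≠ x → w ≠ y → Above τ y w) := by
  obtain ⟨e, hx, hy⟩ : ∃ e : Equiv.Perm (Fin k),
      e x = ⟨0, by omega⟩ ∧ e y = ⟨1, by omega⟩ := by
    have h01 : (⟨0, by omega⟩ : Fin k) ≠ ⟨1, by omega⟩ := by simp
    have hne : Equiv.swap x (⟨0, by omega⟩ : Fin k) y ≠ ⟨0, by omega⟩ := by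
      intro h
      apply hxy
      apply (Equiv.swap x (⟨0, by omega⟩ : Fin k)).injective
      rw [h, Equiv.swap_apply_left]
    refine ⟨(Equiv.swap x (⟨0, by omega⟩ : Fin k)).trans
      (Equiv.swap (Equiv.swap x (⟨0, by omega⟩ : Fin k) y) ⟨1, by omega⟩), ?_, ?_⟩
    · rw [Equiv.trans_apply, Equiv.swap_apply_left,
        Equiv.swap_apply_of_ne_of_ne hne.symm h01]
    · rw [Equiv.trans_apply, Equiv.swap_apply_left]
  refine ⟨e.symm, ?_, ?_⟩
  · intro w hw
    have h1 : e w ≠ e x := fun h => hw (e.injective h)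
    rw [hx] at h1
    simp only [Above, Equiv.symm_symm, hx, Fin.lt_def]
    simp only [ne_eq, Fin.ext_iff] at h1
    omega
  · intro w hw hw'
    have h1 : e w ≠ e x := fun h => hw (e.injective h)
    have h2 : e w ≠ e y := fun h => hw' (e.injective h)
    rw [hx] at h1
    rw [hy] at h2
    simp only [Above, Equiv.symm_symm, hy, Fin.lt_def]
    simp only [ne_eq, Fin.ext_iff] at h1 h2
    omega

theorem above_or {k : ℕ} (τ : Equiv.Perm (Fin k)) {x y : Fin k} (h : x ≠ y) :
    Above τ x y ∨ Above τ y x :=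
  lt_or_gt_of_ne (fun e => h (τ.symm.injective e))

/-- Two-voter core. -/
theorem core {k : ℕ} (hk : 3 ≤ k)
    (F : Equiv.Perm (Fin k) → Equiv.Perm (Fin k) → Fin k)
    (h0 : ∀ τ τ' ρ, ¬ Above τ (F τ' ρ) (F τ ρ))
    (h1 : ∀ τ ρ ρ', ¬ Above ρ (F τ ρ') (F τ ρ))
    (a b : Fin k) (hab : a ≠ b) (p q : Equiv.Perm (Fin k))
    (hp : Above p a b) (hq : Above q a b)
    (hF : ∀ τ, F τ p = a ∨ F τ p = b)
    (ha : ∃ τ, F τ p = a) (hb : ∃ τ, F τ p = b) (τ : Equiv.Perm (Fin k)) :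
    F τ q = F τ p := by
  have key : F τ q = a ∨ F τ q = b := by
    by_contra hcon
    push Not at hcon
    obtain ⟨hca, hcb⟩ := hcon
    generalize hc : F τ q = c at hca hcb
    obtain ⟨τ1, t1c, t1b⟩ := exists_top_two hk c b hcb
    obtain ⟨τ2, t2c, t2a⟩ := exists_top_two hk c a hca
    obtain ⟨ρ, ra, rc⟩ := exists_top_two hk a c hca.symm
    obtain ⟨τa, hτa⟩ := ha
    obtain ⟨τb, hτb⟩ := hb
    have e1 : F τ1 p = b := by
      rcases hF τ1 with h | h
      · exact absurd (by rw [h, hτb]; exact t1b a hca.symm hab) (h0 τ1 τb p)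
      · exact h
    have e2 : F τ2 p = a := by
      rcases hF τ2 with h | h
      · exact h
      · exact absurd (by rw [h, hτa]; exact t2a b hcb.symm hab.symm) (h0 τ2 τa p)
    have e3 : F τ1 q = c := by
      by_contra h
      exact h0 τ1 τ q (by rw [hc]; exact t1c _ h)
    have e4 : F τ1 ρ ≠ a := by
      intro h
      exact h1 τ1 p ρ (by rw [h, e1]; exact hp)
    have e5 : F τ1 ρ = c := by
      by_contra h
      exact h1 τ1 ρ q (by rw [e3]; exact rc _ e4 h)
    have e6 : F τ2 ρ = a := by
      by_contra h
      exact h1 τ2 ρ p (by rw [e2]; exact ra _ h)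
    exact h0 τ2 τ1 ρ (by rw [e5, e6]; exact t2c _ hca.symm)
  rcases key with h | h <;> rcases hF τ with h' | h'
  · rw [h, h']
  · exact absurd (by rw [h, h']; exact hp) (h1 τ p q)
  · exact absurd (by rw [h, h']; exact hq) (h1 τ q p)
  · rw [h, h']

theorem stmt9 (n k : ℕ) (hn : 2 ≤ n) (hk : 3 ≤ k)
    (f : Profile n k → Fin k) (a b : Fin k) (hab : a ≠ b)
    (σ : Profile n k) (z : Fin n → Bool)
    (hσ : InFiberBdry f ⟨0, by omega⟩ a b z σ) :
    InD1 f ⟨0, by omega⟩ a b σ ∨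
      ∃ (σh : Profile n k) (j : Fin n), IsManipPoint f σh ∧
        ∀ m : Fin n, m ≠ ⟨0, by omega⟩ → m ≠ j → σh m = σ m := by
  classical
  by_contra hcon
  push Not at hcon
  obtain ⟨hD, hM⟩ := hcon
  generalize hv : (⟨0, by omega⟩ : Fin n) = v at *
  obtain ⟨⟨hfib, hfa, σ', -, hσ', hfb⟩, π, ⟨i, hi, hπ⟩, hπfib, hπB⟩ := hσ
  have noman : ∀ (j : Fin n) (s s' : Profile n k) (m : Fin n),
      (∀ l, l ≠ v → l ≠ j → s l = σ l) → (∀ l, l ≠ m → s l = s' l) →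
      ¬ Above (s m) (f s') (f s) := by
    intro j s s' m hs hss hab'
    obtain ⟨l, hl1, hl2, hl3⟩ := hM s j ⟨s', m, by
      refine ⟨?_, hss, hab'⟩
      intro hm
      have : s = s' := by
        funext l
        by_cases hl : l = m
        · rw [hl, hm]
        · exact hss l hl
      rw [this] at hab'
      exact lt_irrefl _ hab'⟩
    exact hl3 (hs l hl1 hl2)
  have g0 : ∀ τ τ' : Equiv.Perm (Fin k),
      ¬ Above τ (f (Function.update σ v τ')) (f (Function.update σ v τ)) := by
    intro τ τ'
    have := noman v (Function.update σ v τ) (Function.update σ v τ') v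
      (by intro l hl _; simp [hl]) (by intro l hl; simp [hl])
    simpa using this
  have hσeq : Function.update σ v (σ v) = σ := Function.update_eq_self v σ
  have hσ'eq : Function.update σ v (σ' v) = σ' := by
    funext l
    by_cases hl : l = v
    · subst hl; simp
    · simp [hl, hσ' l hl]
  have two : ∀ τ, f (Function.update σ v τ) = a ∨ f (Function.update σ v τ) = b := by
    by_contra hc
    push Not at hc
    obtain ⟨τ, hca, hcb⟩ := hc
    apply hD
    refine ⟨Finset.univ.image (fun τ => f (Function.update σ v τ)), ?_, ?_, ?_, ?_⟩
    · exact Finset.mem_image.2 ⟨σ v, by simp, by rw [hσeq, hfa]⟩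
    · exact Finset.mem_image.2 ⟨σ' v, by simp, by rw [hσ'eq, hfb]⟩
    · have h3 : ({a, b, f (Function.update σ v τ)} : Finset (Fin k)).card = 3 :=
        Finset.card_eq_three.2 ⟨_, _, _, hab, hca.symm, hcb.symm, rfl⟩
      rw [← h3]
      apply Finset.card_le_card
      intro x hx
      simp only [Finset.mem_insert, Finset.mem_singleton] at hx
      rcases hx with rfl | rfl | rfl
      · exact Finset.mem_image.2 ⟨σ v, by simp, by rw [hσeq, hfa]⟩
      · exact Finset.mem_image.2 ⟨σ' v, by simp, by rw [hσ'eq, hfb]⟩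
      · exact Finset.mem_image.2 ⟨τ, by simp, rfl⟩
    · intro τ
      refine ⟨Finset.mem_image.2 ⟨τ, by simp, rfl⟩, ?_⟩
      intro c hc hne
      obtain ⟨τ', -, rfl⟩ := Finset.mem_image.1 hc
      rcases above_or τ hne with h | h
      · exact absurd h (g0 τ τ')
      · exact h
  have hza : Above (σ v) a b := by
    rcases above_or (σ v) hab with h | h
    · exact h
    · refine absurd ?_ (g0 (σ v) (σ' v))
      rw [hσeq, hσ'eq, hfa, hfb]
      exact h
  apply hπB
  refine ⟨hπfib, ?_⟩
  -- it suffices to show the two values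
  suffices hs : f π = a ∧ ∃ τ, f (Function.update π v τ) = b by
    obtain ⟨hs1, τ, hs2⟩ := hs
    refine ⟨hs1, Function.update π v τ, ?_, ?_, hs2⟩
    · intro h
      apply hab
      rw [← hs1, ← hs2]
      congr 1
      funext l
      by_cases hl : l = v
      · rw [hl, h]
      · simp [hl]
    · intro l hl
      simp [hl]
  by_cases hiv : i = v
  · subst hiv
    have hup : ∀ τ, Function.update π i τ = Function.update σ i τ := by
      intro τ
      funext l
      by_cases hl : l = i
      · subst hl; simp
      · simp [hl, hπ l hl]
    have hπeq : Function.update σ i (π i) = π := by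
      rw [← hup]; exact Function.update_eq_self i π
    refine ⟨?_, σ' i, by rw [hup, hσ'eq, hfb]⟩
    have hπa : Above (π i) a b := (hπfib i).2 ((hfib i).1 hza)
    rcases two (π i) with h | h
    · rwa [hπeq] at h
    · refine absurd ?_ (g0 (π i) (σ i))
      rw [hσeq, hfa, h]
      exact hπa
  · have hvi : v ≠ i := fun h => hiv h.symm
    let F : Equiv.Perm (Fin k) → Equiv.Perm (Fin k) → Fin k :=
      fun τ ρ => f (Function.update (Function.update σ i ρ) v τ)
    have hFp : ∀ τ, F τ (σ i) = f (Function.update σ v τ) := by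
      intro τ
      simp only [F, Function.update_eq_self]
    have hπi : Function.update σ i (π i) = π := by
      funext l
      by_cases hl : l = i
      · subst hl; simp
      · simp [hl, hπ l hl]
    have hFq : ∀ τ, F τ (π i) = f (Function.update π v τ) := by
      intro τ
      simp only [F, hπi]
    have h0 : ∀ τ τ' ρ, ¬ Above τ (F τ' ρ) (F τ ρ) := by
      intro τ τ' ρ
      have := noman i (Function.update (Function.update σ i ρ) v τ)
        (Function.update (Function.update σ i ρ) v τ') v
        (by intro l hl hl'; simp [hl, hl']) (by intro l hl; simp [hl])
      simpa [F] using this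
    have h1 : ∀ τ ρ ρ', ¬ Above ρ (F τ ρ') (F τ ρ) := by
      intro τ ρ ρ'
      have := noman i (Function.update (Function.update σ i ρ) v τ)
        (Function.update (Function.update σ i ρ') v τ) i
        (by intro l hl hl'; simp [hl, hl'])
        (by intro l hl; by_cases hlv : l = v
            · subst hlv; simp
            · simp [hl, hlv])
      simpa [F, hiv] using this
    have ha : F (σ v) (σ i) = a := by rw [hFp, hσeq, hfa]
    have hb : F (σ' v) (σ i) = b := by rw [hFp, hσ'eq, hfb]
    have hF : ∀ τ, F τ (σ i) = a ∨ F τ (σ i) = b := by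
      intro τ; rw [hFp]; exact two τ
    have hmain : ∀ τ, F τ (π i) = F τ (σ i) := by
      rcases above_or (σ i) hab with h | h
      · exact core hk F h0 h1 a b hab (σ i) (π i) h ((hπfib i).2 ((hfib i).1 h)) hF
          ⟨_, ha⟩ ⟨_, hb⟩
      · have hq : Above (π i) b a := by
          rcases above_or (π i) hab with h' | h'
          · exact absurd ((hfib i).2 ((hπfib i).1 h')) (lt_asymm h)
          · exact h'
        exact core hk F h0 h1 b a hab.symm (σ i) (π i) h hq (fun τ => (hF τ).symm)
          ⟨_, hb⟩ ⟨_, ha⟩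
    refine ⟨?_, σ' v, by rw [← hFq, hmain, hb]⟩
    have := hmain (σ v)
    rw [ha, hFq, hπ v hvi, Function.update_eq_self] at this
    exact this
end

section
/- Let k ≥ 3 and 0 < ε ≤ 1, and let f : S_k → [k] be an SCF on one voter with D(f, NONMANIP(1,k)) ≥ ε. Then either P(σ ∈ M_2(f)) ≥ 4ε/k^6, or there exist distinct alternatives a, b ∈ [k] such that (1/2) · P(f(σ) = a and f([a:b]σ) = b) ≥ 2ε/k^6. -/
open Finset

/-- `σ` is a manipulation point of the one-voter SCF `f`. -/
def IsMPoint1 {k : ℕ} (f : Equiv.Perm (Fin k) → Fin k) (σ : Equiv.Perm (Fin k)) : Prop :=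
  ∃ σ', σ ≠ σ' ∧ Above σ (f σ') (f σ)

/-- `σ` is an `r`-manipulation point of the one-voter SCF `f`, i.e. `σ ∈ M_r(f)`. -/
def IsMPointR1 {k : ℕ} (r : ℕ) (f : Equiv.Perm (Fin k) → Fin k)
    (σ : Equiv.Perm (Fin k)) : Prop :=
  ∃ σ', σ ≠ σ' ∧ Above σ (f σ') (f σ) ∧ AgreeOutsideBlock r σ σ'

/-- `f = top_H`: `f` always elects the top alternative among `H`. -/
def IsTop1 {k : ℕ} (f : Equiv.Perm (Fin k) → Fin k) (H : Finset (Fin k)) : Prop :=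
  ∀ σ, f σ ∈ H ∧ ∀ b ∈ H, b ≠ f σ → Above σ (f σ) b

/-- `f` takes exactly two values. -/
def TakesExactlyTwoValues1 {k : ℕ} (f : Equiv.Perm (Fin k) → Fin k) : Prop :=
  ∃ a b : Fin k, a ≠ b ∧ (∀ σ, f σ = a ∨ f σ = b) ∧ (∃ σ, f σ = a) ∧ (∃ σ, f σ = b)

/-- `f` is monotone (one-voter version). -/
def IsMonotone1 {k : ℕ} (f : Equiv.Perm (Fin k) → Fin k) : Prop :=
  ∀ σ σ', f σ ≠ f σ' → Above σ' (f σ') (f σ)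

/-- The family `NONMANIP(1,k)` of nonmanipulable one-voter social choice functions. -/
def InNonManip1 {k : ℕ} (f : Equiv.Perm (Fin k) → Fin k) : Prop :=
  (∃ H : Finset (Fin k), H.Nonempty ∧ IsTop1 f H) ∨
  (TakesExactlyTwoValues1 f ∧ IsMonotone1 f)

/-- `[a:b]σ`: swap `a` and `b` in `σ` if they occupy adjacent positions,
and `σ` otherwise. -/
def adjSwap {k : ℕ} (a b : Fin k) (σ : Equiv.Perm (Fin k)) : Equiv.Perm (Fin k) :=
  if (σ.symm a : ℕ) + 1 = (σ.symm b : ℕ) ∨ (σ.symm b : ℕ) + 1 = (σ.symm a : ℕ)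
  then Equiv.swap a b * σ else σ

/-- `σ ∈ F̄`: `a` occupies the position directly above `b` in `σ`. -/
def Fbar {k : ℕ} (a b : Fin k) (σ : Equiv.Perm (Fin k)) : Prop :=
  (σ.symm a : ℕ) + 1 = (σ.symm b : ℕ)

/-- `σ ∈ B`: `f σ = a`, `f([a:b]σ) = b` and `a` is above `b` in `σ`. -/
def BSet {k : ℕ} (f : Equiv.Perm (Fin k) → Fin k) (a b : Fin k)
    (σ : Equiv.Perm (Fin k)) : Prop :=
  f σ = a ∧ f (adjSwap a b σ) = b ∧ Above σ a b

/-- Adjacency in the graph `G` on `F̄`: transposing two elements in adjacent positions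
when the adjacent pair `a,b` is treated as a single block element (either swapping two
elements neither of which is `a` or `b`, or moving the `a,b`-block up or down by one). -/
def GAdj {k : ℕ} (a b : Fin k) (σ π : Equiv.Perm (Fin k)) : Prop :=
  Fbar a b σ ∧ Fbar a b π ∧
    ((∃ p q : Fin k, (p : ℕ) + 1 = (q : ℕ) ∧ σ p ≠ a ∧ σ p ≠ b ∧ σ q ≠ a ∧ σ q ≠ b ∧
        π = σ * Equiv.swap p q) ∨
     (∃ p q r : Fin k, (p : ℕ) + 1 = (q : ℕ) ∧ (q : ℕ) + 1 = (r : ℕ) ∧ σ q = a ∧ σ r = b ∧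
        π = σ * (Equiv.swap p r * Equiv.swap p q)) ∨
     (∃ p q r : Fin k, (p : ℕ) + 1 = (q : ℕ) ∧ (q : ℕ) + 1 = (r : ℕ) ∧ σ p = a ∧ σ q = b ∧
        π = σ * (Equiv.swap p q * Equiv.swap p r)))

/-- `σ ∈ ∂(B)`: `σ ∈ B` and `σ` has a `G`-neighbor in `F̄ ∖ B`. -/
def InBdryB {k : ℕ} (f : Equiv.Perm (Fin k) → Fin k) (a b : Fin k)
    (σ : Equiv.Perm (Fin k)) : Prop :=
  BSet f a b σ ∧ ∃ π, GAdj a b σ π ∧ ¬ BSet f a b π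

/-- `σ ∈ LD^H`: `σ` is a local dictator on `H`: the alternatives of `H` occupy a block
of consecutive positions in `σ`, and for every `σ'` obtained from `σ` by permuting the
alternatives of `H` within this block, `f σ'` is the top-ranked alternative of `H` in `σ'`. -/
def IsLocalDict {k : ℕ} (f : Equiv.Perm (Fin k) → Fin k) (H : Finset (Fin k))
    (σ : Equiv.Perm (Fin k)) : Prop :=
  (∃ l : ℕ, ∀ x : Fin k, σ x ∈ H ↔ l ≤ (x : ℕ) ∧ (x : ℕ) < l + H.card) ∧
  ∀ σ' : Equiv.Perm (Fin k), (∀ x, σ x ∉ H → σ' x = σ x) →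
    f σ' ∈ H ∧ ∀ c ∈ H, c ≠ f σ' → Above σ' (f σ') c

/-- `σ ∈ LD(a,b) = ∪_{c ∉ {a,b}} LD^{{a,b,c}}`. -/
def InLD {k : ℕ} (f : Equiv.Perm (Fin k) → Fin k) (a b : Fin k)
    (σ : Equiv.Perm (Fin k)) : Prop :=
  ∃ c, c ≠ a ∧ c ≠ b ∧ IsLocalDict f ({a, b, c} : Finset (Fin k)) σ

/-- `τ'` is obtained from `τ` by moving only the alternative `c` (the relative order of
all other alternatives is unchanged). -/
def MovedOnly {k : ℕ} (c : Fin k) (τ τ' : Equiv.Perm (Fin k)) : Prop :=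
  ∀ x y, x ≠ c → y ≠ c → (Above τ x y ↔ Above τ' x y)

/-- `σ ∈ V_{(a,b,c)}`: the top three positions of `σ` hold `a`, `b`, `c` in this order. -/
def VSet {k : ℕ} (a b c : Fin k) (σ : Equiv.Perm (Fin k)) : Prop :=
  ∃ p q r : Fin k, (p : ℕ) = 0 ∧ (q : ℕ) = 1 ∧ (r : ℕ) = 2 ∧ σ p = a ∧ σ q = b ∧ σ r = c

/-- Adjacency in the graph `G_{(a,b,c)}`: both in `V_{(a,b,c)}` and differing by
transposing the alternatives in two adjacent positions. -/
def VAdj {k : ℕ} (a b c : Fin k) (σ π : Equiv.Perm (Fin k)) : Prop :=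
  VSet a b c σ ∧ VSet a b c π ∧ σ ≠ π ∧
    ∃ p q : Fin k, (p : ℕ) + 1 = (q : ℕ) ∧ π = σ * Equiv.swap p q

/-- `σ ∈ T(a,b,c) = V_{(a,b,c)} ∩ LD^{{a,b,c}}`. -/
def TSet {k : ℕ} (f : Equiv.Perm (Fin k) → Fin k) (a b c : Fin k)
    (σ : Equiv.Perm (Fin k)) : Prop :=
  VSet a b c σ ∧ IsLocalDict f ({a, b, c} : Finset (Fin k)) σ

/-- `σ ∈ ∂(T(a,b,c))`. -/
def InBdryT {k : ℕ} (f : Equiv.Perm (Fin k) → Fin k) (a b c : Fin k)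
    (σ : Equiv.Perm (Fin k)) : Prop :=
  TSet f a b c σ ∧ ∃ π, VAdj a b c σ π ∧ ¬ TSet f a b c π

open Classical in
/-- number of `σ` at which right translation by `g` changes the value of `f` -/
noncomputable def sens {k : ℕ} (f : Equiv.Perm (Fin k) → Fin k) (g : Equiv.Perm (Fin k)) : ℝ :=
  ((Finset.univ.filter (fun σ => f σ ≠ f (σ * g))).card : ℝ)

lemma sens_mul {k : ℕ} (f : Equiv.Perm (Fin k) → Fin k) (g h : Equiv.Perm (Fin k)) :
    sens f (g * h) ≤ sens f g + sens f h := by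
  classical
  unfold sens
  have h2 : (Finset.univ.filter (fun σ => f (σ * g) ≠ f (σ * g * h))).card
      = (Finset.univ.filter (fun σ => f σ ≠ f (σ * h))).card := by
    apply Finset.card_equiv (Equiv.mulRight g)
    intro σ
    simp
  have h1 : (Finset.univ.filter (fun σ => f σ ≠ f (σ * (g * h)))) ⊆
      (Finset.univ.filter (fun σ => f σ ≠ f (σ * g))) ∪
      (Finset.univ.filter (fun σ => f (σ * g) ≠ f (σ * g * h))) := by
    intro σ hσ
    simp only [Finset.mem_filter, Finset.mem_univ, true_and, Finset.mem_union, ← mul_assoc] at *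
    by_contra hc
    push Not at hc
    exact hσ (hc.1.trans hc.2)
  have h3 := (Finset.card_le_card h1).trans (Finset.card_union_le _ _)
  rw [h2] at h3
  exact_mod_cast h3

lemma sens_swap {k : ℕ} (f : Equiv.Perm (Fin k) → Fin k) (m : ℝ)
    (hm : ∀ p q : Fin k, (p : ℕ) + 1 = (q : ℕ) → sens f (Equiv.swap p q) ≤ m) (d : ℕ) :
    ∀ p q : Fin k, (p : ℕ) + (d + 1) = (q : ℕ) →
      sens f (Equiv.swap p q) ≤ (2 * d + 1) * m := by
  induction d with
  | zero => intro p q h; simpa using hm p q (by omega)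
  | succ d ih =>
    intro p q h
    have hq := q.2
    let r : Fin k := ⟨(p : ℕ) + (d + 1), by omega⟩
    have h1 := ih p r rfl
    have h2 := hm r q (by simp only [r]; omega)
    have hpr : p ≠ r := by intro h; have := congrArg Fin.val h; simp only [r] at this; omega
    have hpq : p ≠ q := by intro h; have := congrArg Fin.val h; omega
    have e : Equiv.swap p q = Equiv.swap r q * (Equiv.swap p r * Equiv.swap r q) := by
      rw [← mul_assoc, Equiv.swap_mul_swap_mul_swap hpr hpq, Equiv.swap_comm]
    rw [e]
    have h3 := sens_mul f (Equiv.swap r q) (Equiv.swap p r * Equiv.swap r q)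
    have h4 := sens_mul f (Equiv.swap p r) (Equiv.swap r q)
    push_cast
    linarith

lemma sens_swap' {k : ℕ} (f : Equiv.Perm (Fin k) → Fin k) (m : ℝ) (hm0 : 0 ≤ m)
    (hm : ∀ p q : Fin k, (p : ℕ) + 1 = (q : ℕ) → sens f (Equiv.swap p q) ≤ m)
    (p q : Fin k) (hpq : p ≠ q) : sens f (Equiv.swap p q) ≤ (2 * k - 3) * m := by
  have main : ∀ p q : Fin k, p < q → sens f (Equiv.swap p q) ≤ (2 * k - 3) * m := by
    intro p q h
    have hq := q.2
    have h' : (p : ℕ) < q := h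
    obtain ⟨d, hd⟩ : ∃ d, (p : ℕ) + (d + 1) = q := ⟨q - p - 1, by omega⟩
    refine (sens_swap f m hm d p q hd).trans ?_
    have : ((d + 2 : ℕ) : ℝ) ≤ k := by exact_mod_cast (by omega)
    push_cast at this
    apply mul_le_mul_of_nonneg_right _ hm0
    linarith
  rcases lt_or_gt_of_ne hpq with h | h
  · exact main p q h
  · rw [Equiv.swap_comm]; exact main q p h

lemma sens_le {k : ℕ} (f : Equiv.Perm (Fin k) → Fin k) (m : ℝ) (h0 : 0 ≤ m)
    (hm : ∀ p q : Fin k, p ≠ q → sens f (Equiv.swap p q) ≤ m) (n : ℕ) :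
    ∀ g : Equiv.Perm (Fin k), g.support.card ≤ n → sens f g ≤ n * m := by
  induction n with
  | zero =>
    intro g hg
    have : g = 1 := by
      rw [← Equiv.Perm.support_eq_empty_iff, ← Finset.card_eq_zero]; omega
    subst this
    simp [sens]
  | succ n ih =>
    intro g hg
    by_cases h1 : ∃ x, g x ≠ x
    · obtain ⟨x, hx⟩ := h1
      have hlt := Equiv.Perm.card_support_swap_mul hx
      have h2 := ih (Equiv.swap x (g x) * g) (by omega)
      have h3 := hm x (g x) hx.symm
      have h4 := sens_mul f (Equiv.swap x (g x)) (Equiv.swap x (g x) * g)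
      rw [Equiv.swap_mul_self_mul] at h4
      push_cast
      linarith
    · push Not at h1
      have : g = 1 := Equiv.ext h1
      subst this
      simp only [sens, mul_one, ne_eq, not_true_eq_false, Finset.filter_false, Finset.card_empty]
      push_cast
      positivity

lemma edge_cover {k : ℕ} (f : Equiv.Perm (Fin k) → Fin k) (p q : Fin k)
    (hpq : (p : ℕ) + 1 = (q : ℕ)) (σ : Equiv.Perm (Fin k))
    (hf : f σ ≠ f (σ * Equiv.swap p q)) :
    IsMPointR1 2 f σ ∨ IsMPointR1 2 f (σ * Equiv.swap p q) ∨
      f (adjSwap (f σ) (f (σ * Equiv.swap p q)) σ) = f (σ * Equiv.swap p q) := by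
  have hne : σ ≠ σ * Equiv.swap p q := fun h => hf (congrArg f h)
  have hagree : ∀ x : Fin k, ((x : ℕ) < p ∨ (p : ℕ) + 2 ≤ x) → σ x = (σ * Equiv.swap p q) x := by
    intro x hx
    rw [Equiv.Perm.mul_apply, Equiv.swap_apply_of_ne_of_ne]
    · rintro rfl; omega
    · rintro rfl; omega
  have hsymm : ∀ z, (σ * Equiv.swap p q).symm z = Equiv.swap p q (σ.symm z) := by
    intro z
    rw [Equiv.symm_apply_eq]; simp
  set τ := σ * Equiv.swap p q with hτ
  set a := f σ
  set b := f τ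
  have hab : σ.symm a ≠ σ.symm b := fun h => hf (σ.symm.injective h)
  have hsw : ∀ {x y : Fin k}, σ.symm x = p → σ.symm y = q → Equiv.swap x y * σ = τ := by
    intro x y hx hy
    rw [hτ, Equiv.mul_swap_eq_swap_mul, ← hx, ← hy]; simp
  rcases lt_or_gt_of_ne hab with h | h
  · by_cases hc : σ.symm a = p ∧ σ.symm b = q
    · right; right
      have : adjSwap a b σ = τ := by
        unfold adjSwap
        rw [if_pos (by rw [hc.1, hc.2]; exact Or.inl hpq)]
        exact hsw hc.1 hc.2
      rw [this]
    · right; left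
      refine ⟨σ, hne.symm, ?_, p, fun x hx => (hagree x hx).symm⟩
      unfold Above
      change τ.symm a < τ.symm b
      rw [hsymm, hsymm, Equiv.swap_apply_def, Equiv.swap_apply_def]
      simp only [Fin.ext_iff, Fin.lt_def] at *
      split_ifs <;> omega
  · left
    exact ⟨τ, hne, h, p, hagree⟩

lemma const_nonmanip {k : ℕ} (c : Fin k) :
    InNonManip1 (fun _ : Equiv.Perm (Fin k) => c) := by
  refine Or.inl ⟨{c}, by simp, fun σ => ⟨by simp, ?_⟩⟩
  intro b hb hne
  exact absurd (by simpa using hb) hne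

lemma arith_bound (k : ℝ) (hk : 3 ≤ k) : k * ((2 * k - 3) * ((k ^ 2 + 2) * 4)) < k ^ 6 := by
  obtain ⟨j, rfl⟩ : ∃ j, k = j + 3 := ⟨k - 3, by ring⟩
  have hj : 0 ≤ j := by linarith
  rw [← sub_pos]
  ring_nf
  positivity

theorem stmt11 (k : ℕ) (hk : 3 ≤ k) (ε : ℝ) (hε0 : 0 < ε) (hε1 : ε ≤ 1)
    (f : Equiv.Perm (Fin k) → Fin k)
    (hD : ∀ g : Equiv.Perm (Fin k) → Fin k, InNonManip1 g →
      ε ≤ prob (fun σ : Equiv.Perm (Fin k) => f σ ≠ g σ)) :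
    4 * ε / (k : ℝ) ^ 6 ≤ prob (fun σ : Equiv.Perm (Fin k) => IsMPointR1 2 f σ) ∨
      ∃ a b : Fin k, a ≠ b ∧
        2 * ε / (k : ℝ) ^ 6 ≤
          (1 / 2) * prob (fun σ : Equiv.Perm (Fin k) => f σ = a ∧ f (adjSwap a b σ) = b) := by
  classical
  by_contra hcon
  push Not at hcon
  obtain ⟨hM, hB⟩ := hcon
  have hk3 : (3 : ℝ) ≤ k := by exact_mod_cast hk
  have hk6 : (0 : ℝ) < (k : ℝ) ^ 6 := by positivity
  set K : ℝ := (Fintype.card (Equiv.Perm (Fin k)) : ℝ) with hK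
  have hKpos : 0 < K := by rw [hK]; exact_mod_cast Fintype.card_pos
  have hprob : ∀ p : Equiv.Perm (Fin k) → Prop,
      prob p = ((Finset.univ.filter p).card : ℝ) / K := by
    intro p; unfold prob; rfl
  set T : ℝ := 4 * ε / (k : ℝ) ^ 6 * K with hT
  have hTpos : 0 < T := by positivity
  have hM' : ((Finset.univ.filter (fun σ => IsMPointR1 2 f σ)).card : ℝ) ≤ T := by
    rw [hprob, div_lt_iff₀ hKpos] at hM
    exact hM.le
  have hB' : ∀ a b : Fin k, a ≠ b →
      ((Finset.univ.filter (fun σ => f σ = a ∧ f (adjSwap a b σ) = b)).card : ℝ) ≤ T := by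
    intro a b hab
    have h := hB a b hab
    have h2 : prob (fun σ : Equiv.Perm (Fin k) => f σ = a ∧ f (adjSwap a b σ) = b)
        < 4 * ε / (k : ℝ) ^ 6 := by
      have e : 4 * ε / (k : ℝ) ^ 6 = 2 * (2 * ε / (k : ℝ) ^ 6) := by ring
      rw [e]; linarith
    rw [hprob, div_lt_iff₀ hKpos] at h2
    refine le_trans (le_of_eq ?_) h2.le
    congr!
  -- bound on the sensitivity for adjacent transpositions
  have hadj : ∀ p q : Fin k, (p : ℕ) + 1 = (q : ℕ) →
      sens f (Equiv.swap p q) ≤ ((k : ℝ) ^ 2 + 2) * T := by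
    intro p q hpq
    have hsub : (Finset.univ.filter (fun σ => f σ ≠ f (σ * Equiv.swap p q))) ⊆
        (Finset.univ.filter (fun σ => IsMPointR1 2 f σ) ∪
         Finset.univ.filter (fun σ => IsMPointR1 2 f (σ * Equiv.swap p q))) ∪
        ((Finset.univ : Finset (Fin k)).offDiag).biUnion
          (fun x => Finset.univ.filter (fun σ => f σ = x.1 ∧ f (adjSwap x.1 x.2 σ) = x.2)) := by
      intro σ hσ
      have hσ' : f σ ≠ f (σ * Equiv.swap p q) := by simpa using hσ
      simp only [Finset.mem_union, Finset.mem_filter, Finset.mem_univ, true_and,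
        Finset.mem_biUnion, Finset.mem_offDiag]
      rcases edge_cover f p q hpq σ hσ' with h | h | h
      · exact Or.inl (Or.inl h)
      · exact Or.inl (Or.inr h)
      · exact Or.inr ⟨(f σ, f (σ * Equiv.swap p q)), hσ', rfl, h⟩
    have hshift : (Finset.univ.filter (fun σ => IsMPointR1 2 f (σ * Equiv.swap p q))).card =
        (Finset.univ.filter (fun σ => IsMPointR1 2 f σ)).card := by
      apply Finset.card_equiv (Equiv.mulRight (Equiv.swap p q))
      intro σ
      simp
    have hbi : ((((Finset.univ : Finset (Fin k)).offDiag).biUnion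
          (fun x => Finset.univ.filter
            (fun σ => f σ = x.1 ∧ f (adjSwap x.1 x.2 σ) = x.2))).card : ℝ) ≤ (k : ℝ) ^ 2 * T := by
      have h1 : ((((Finset.univ : Finset (Fin k)).offDiag).biUnion
          (fun x => Finset.univ.filter
            (fun σ => f σ = x.1 ∧ f (adjSwap x.1 x.2 σ) = x.2))).card : ℝ) ≤
          ∑ x ∈ (Finset.univ : Finset (Fin k)).offDiag, ((Finset.univ.filter
            (fun σ => f σ = x.1 ∧ f (adjSwap x.1 x.2 σ) = x.2)).card : ℝ) := by
        exact_mod_cast Finset.card_biUnion_le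
      refine h1.trans ?_
      have h2 := Finset.sum_le_card_nsmul (Finset.univ : Finset (Fin k)).offDiag
        (fun x => ((Finset.univ.filter
            (fun σ => f σ = x.1 ∧ f (adjSwap x.1 x.2 σ) = x.2)).card : ℝ)) T
        (fun x hx => hB' x.1 x.2 (Finset.mem_offDiag.1 hx).2.2)
      refine h2.trans ?_
      rw [nsmul_eq_mul]
      apply mul_le_mul_of_nonneg_right _ hTpos.le
      rw [Finset.offDiag_card, Finset.card_univ, Fintype.card_fin]
      have : k * k - k ≤ k ^ 2 := by rw [sq]; exact Nat.sub_le _ _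
      exact_mod_cast this
    have hc1 := (Finset.card_le_card hsub).trans (Finset.card_union_le _ _)
    have hc2 := Finset.card_union_le (Finset.univ.filter (fun σ => IsMPointR1 2 f σ))
      (Finset.univ.filter (fun σ => IsMPointR1 2 f (σ * Equiv.swap p q)))
    rw [hshift] at hc2
    have hc3 := hc1.trans (Nat.add_le_add_right hc2 _)
    have hc4 := (Nat.cast_le (α := ℝ)).2 hc3
    push_cast at hc4
    unfold sens
    linarith
  have hm0 : 0 ≤ ((k : ℝ) ^ 2 + 2) * T := by positivity
  have hsw := sens_swap' f _ hm0 hadj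
  have h23 : (0 : ℝ) ≤ 2 * k - 3 := by linarith
  have hall : ∀ g, sens f g ≤ k * ((2 * k - 3) * (((k : ℝ) ^ 2 + 2) * T)) := by
    intro g
    apply sens_le f _ (mul_nonneg h23 hm0) hsw k g
    simpa using Finset.card_le_univ g.support
  have hlt : (k : ℝ) * ((2 * k - 3) * (((k : ℝ) ^ 2 + 2) * T)) < ε * K := by
    have h := arith_bound k hk3
    have e : (k : ℝ) * ((2 * k - 3) * (((k : ℝ) ^ 2 + 2) * T)) =
        (k * ((2 * k - 3) * ((k ^ 2 + 2) * 4))) / (k : ℝ) ^ 6 * (ε * K) := by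
      rw [hT]; ring
    rw [e]
    have h1 : ((k : ℝ) * ((2 * k - 3) * ((k ^ 2 + 2) * 4))) / (k : ℝ) ^ 6 < 1 :=
      (div_lt_one hk6).2 h
    have h2 : 0 < ε * K := by positivity
    exact mul_lt_of_lt_one_left h2 h1
  -- averaging
  have hconst : ∀ σ : Equiv.Perm (Fin k),
      ε * K ≤ ∑ g : Equiv.Perm (Fin k), (if f σ ≠ f (σ * g) then (1 : ℝ) else 0) := by
    intro σ
    have h := hD _ (const_nonmanip (f σ))
    rw [hprob, le_div_iff₀ hKpos] at h
    refine h.trans (le_of_eq ?_)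
    rw [Finset.sum_boole]
    congr 1
    symm
    apply Finset.card_equiv (Equiv.mulLeft σ)
    intro g
    simp [eq_comm]
  have hsum : ∑ _σ : Equiv.Perm (Fin k), ε * K ≤ ∑ g : Equiv.Perm (Fin k), sens f g := by
    refine (Finset.sum_le_sum (fun σ _ => hconst σ)).trans (le_of_eq ?_)
    rw [Finset.sum_comm]
    refine Finset.sum_congr rfl (fun g _ => ?_)
    rw [Finset.sum_boole]
    unfold sens
    congr!
  have hsum2 : ∑ g : Equiv.Perm (Fin k), sens f g < ∑ _g : Equiv.Perm (Fin k), ε * K :=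
    Finset.sum_lt_sum_of_nonempty ⟨1, Finset.mem_univ _⟩
      (fun g _ => (hall g).trans_lt hlt)
  linarith
end

section
/- Let k ≥ 3, 0 < ε ≤ 1, let a ≠ b be alternatives, and let f : S_k → [k] be an SCF on one voter. If P(σ ∈ B | σ ∈ F̄) ≤ 1 − ε/(4k), then P(σ ∈ ∂(B)) ≥ (ε/(2k^4)) · P(σ ∈ B). -/
open Finset

section Helpers

lemma swap_bound {N : ℕ} (D : Equiv.Perm (Fin N) → ℕ) (c : ℕ) (h1 : D 1 = 0)
    (hm : ∀ g h, D (g * h) ≤ D g + D h)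
    (hs : ∀ i j : Fin N, (i : ℕ) + 1 = (j : ℕ) → D (Equiv.swap i j) ≤ c) :
    ∀ (d : ℕ) (i j : Fin N), (i : ℕ) + d = (j : ℕ) → D (Equiv.swap i j) ≤ 2 * d * c := by
  intro d
  induction d with
  | zero =>
    intro i j hij
    have : i = j := by ext; omega
    subst this
    rw [Equiv.swap_self]
    have : D (Equiv.refl (Fin N)) = 0 := h1
    omega
  | succ d ih =>
    intro i j hij
    have hj := j.2
    let m : Fin N := ⟨i + d, by omega⟩
    have hmv : (m : ℕ) = i + d := rfl
    by_cases hd : d = 0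
    · subst hd
      have := hs i j (by omega)
      nlinarith
    have e : Equiv.swap i j = Equiv.swap m j * Equiv.swap i m * Equiv.swap m j := by
      have h1 : i ≠ m := by intro h; rw [Fin.ext_iff] at h; omega
      have h2 : i ≠ j := by intro h; rw [Fin.ext_iff] at h; omega
      have h3 : m ≠ j := by intro h; rw [Fin.ext_iff] at h; omega
      ext x
      simp only [Equiv.Perm.mul_apply, Equiv.swap_apply_def]
      grind
    rw [e]
    have a1 := hm (Equiv.swap m j * Equiv.swap i m) (Equiv.swap m j)
    have a2 := hm (Equiv.swap m j) (Equiv.swap i m)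
    have a3 := hs m j (by omega)
    have a4 := ih i m rfl
    nlinarith

lemma perm_bound {N : ℕ} (D : Equiv.Perm (Fin N) → ℕ) (c : ℕ) (h1 : D 1 = 0)
    (hm : ∀ g h, D (g * h) ≤ D g + D h)
    (hs : ∀ i j : Fin N, (i : ℕ) + 1 = (j : ℕ) → D (Equiv.swap i j) ≤ c)
    (g : Equiv.Perm (Fin N)) : D g ≤ N * (2 * N * c) := by
  have key : ∀ m : ℕ, m ≤ N → ∀ g : Equiv.Perm (Fin N), (∀ x : Fin N, m ≤ (x : ℕ) → g x = x) →
      D g ≤ m * (2 * N * c) := by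
    intro m
    induction m with
    | zero =>
      intro _ g hg
      have : g = 1 := by ext x; rw [hg x (Nat.zero_le _)]; rfl
      rw [this, h1]; simp
    | succ m ih =>
      intro hmN g hg
      let M : Fin N := ⟨m, hmN⟩
      have hle : (g M : ℕ) ≤ m := by
        by_contra hlt
        push Not at hlt
        have := hg (g M) (by omega)
        have := g.injective this
        rw [this] at hlt
        simp [M] at hlt
      have hfix : ∀ x : Fin N, m ≤ (x : ℕ) → (Equiv.swap (g M) M * g) x = x := by
        intro x hx
        rw [Equiv.Perm.mul_apply]
        rcases Nat.eq_or_lt_of_le hx with h | h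
        · have : x = M := by ext; exact h.symm
          subst this
          simp
        · have hgx := hg x h
          rw [hgx]
          apply Equiv.swap_apply_of_ne_of_ne
          · intro hh; rw [← hh] at hle; omega
          · intro hh; rw [hh] at h; simp [M] at h
      have b1 := ih (by omega) _ hfix
      have b2 := hm (Equiv.swap (g M) M) (Equiv.swap (g M) M * g)
      rw [← mul_assoc, Equiv.swap_mul_self, one_mul] at b2
      have b3 := swap_bound D c h1 hm hs (m - (g M : ℕ)) (g M) M (by change (g M : ℕ) + (m - (g M : ℕ)) = m; omega)
      have b4 : 2 * (m - (g M : ℕ)) * c ≤ 2 * N * c := by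
        apply Nat.mul_le_mul_right; omega
      calc D g ≤ _ := b2
        _ ≤ 2 * N * c + m * (2 * N * c) := by omega
        _ = _ := by ring
  exact key N le_rfl g (fun x hx => absurd x.2 (by omega))

open Classical in
lemma expansion {N : ℕ} {Y : Type*} [Fintype Y] [DecidableEq Y] (A : Finset (Fin N ≃ Y)) :
    A.card * Aᶜ.card ≤ Fintype.card (Equiv.Perm (Fin N)) * (N * (2 * N *
      (A.filter (fun x => ∃ i j : Fin N, (i : ℕ) + 1 = (j : ℕ) ∧
        (Equiv.swap i j).trans x ∉ A)).card)) := by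
  set c := (A.filter (fun x => ∃ i j : Fin N, (i : ℕ) + 1 = (j : ℕ) ∧
        (Equiv.swap i j).trans x ∉ A)).card with hc
  let D : Equiv.Perm (Fin N) → ℕ := fun g => (A.filter (fun x => g.trans x ∉ A)).card
  have hD : ∀ g, D g ≤ N * (2 * N * c) := by
    apply perm_bound
    · simp only [D, Finset.card_eq_zero, Finset.filter_eq_empty_iff]
      intro x hx
      have : Equiv.trans (1 : Equiv.Perm (Fin N)) x = x := by ext; rfl
      rw [this]; simpa using hx
    · intro g h
      have hsub : A.filter (fun x => (g * h).trans x ∉ A) ⊆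
          A.filter (fun x => g.trans x ∉ A) ∪
            (Finset.univ.filter (fun x => g.trans x ∈ A ∧ h.trans (g.trans x) ∉ A)) := by
        intro x hx
        have e : (g * h).trans x = h.trans (g.trans x) := by ext; rfl
        simp only [Finset.mem_filter, Finset.mem_union, Finset.mem_univ, true_and, e] at hx ⊢
        tauto
      have hcard : (Finset.univ.filter
          (fun x : Fin N ≃ Y => g.trans x ∈ A ∧ h.trans (g.trans x) ∉ A)).card ≤ D h := by
        apply Finset.card_le_card_of_injOn (fun x => g.trans x)
        · intro x hx
          simpa using hx
        · intro x _ y _ hxy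
          ext i
          have := congrArg (fun e : Fin N ≃ Y => e (g.symm i)) hxy
          simpa using this
      exact (Finset.card_le_card hsub).trans ((Finset.card_union_le _ _).trans (by
        simp only [D] at hcard ⊢; omega))
    · intro i j hij
      apply Finset.card_le_card
      intro x hx
      simp only [Finset.mem_filter] at hx ⊢
      exact ⟨hx.1, i, j, hij, hx.2⟩
  have hsum : ∑ g, D g = A.card * Aᶜ.card := by
    simp only [D, Finset.card_filter]
    rw [Finset.sum_comm, Finset.card_eq_sum_ones A, Finset.sum_mul]
    apply Finset.sum_congr rfl
    intro x _
    rw [one_mul, ← Finset.card_filter]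
    apply Finset.card_bij (fun g _ => g.trans x)
    · intro g hg; simpa using hg
    · intro g _ g' _ hgg
      ext i
      have := congrArg (fun e : Fin N ≃ Y => e i) hgg
      simp at this
      rw [this]
    · intro y hy
      refine ⟨y.trans x.symm, ?_, ?_⟩
      · simp only [Finset.mem_filter, Finset.mem_univ, true_and]
        rw [Equiv.trans_assoc]; simpa using hy
      · rw [Equiv.trans_assoc]; simp
  rw [← hsum]
  calc ∑ g, D g ≤ ∑ _g : Equiv.Perm (Fin N), N * (2 * N * c) := Finset.sum_le_sum (fun g _ => hD g)
    _ = _ := by simp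

/-- Insert `b` directly below `a`. -/
def ins {N : ℕ} {a b : Fin (N + 1)} (hab : a ≠ b) (t : Fin N ≃ {x : Fin (N + 1) // x ≠ b}) :
    Equiv.Perm (Fin (N + 1)) :=
  ((finSuccEquiv' (t.symm ⟨a, hab⟩).succ).trans (Equiv.optionCongr t)).trans
    (Equiv.optionSubtypeNe b)

lemma ins_symm_b {N : ℕ} {a b : Fin (N + 1)} (hab : a ≠ b)
    (t : Fin N ≃ {x : Fin (N + 1) // x ≠ b}) :
    (ins hab t).symm b = (t.symm ⟨a, hab⟩).succ := by
  simp [ins, ← Equiv.optionCongr_symm]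

lemma ins_symm_ne {N : ℕ} {a b : Fin (N + 1)} (hab : a ≠ b)
    (t : Fin N ≃ {x : Fin (N + 1) // x ≠ b}) (x : Fin (N + 1)) (hx : x ≠ b) :
    (((ins hab t).symm x : Fin (N + 1)) : ℕ) =
      if (t.symm ⟨x, hx⟩ : ℕ) ≤ (t.symm ⟨a, hab⟩ : ℕ) then (t.symm ⟨x, hx⟩ : ℕ)
      else (t.symm ⟨x, hx⟩ : ℕ) + 1 := by
  have e : (ins hab t).symm x = (t.symm ⟨a, hab⟩).succ.succAbove (t.symm ⟨x, hx⟩) := by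
    simp [ins, Equiv.optionSubtypeNe_symm_of_ne hx, ← Equiv.optionCongr_symm]
  rw [e, Fin.succAbove]
  simp only [Fin.lt_def, Fin.val_castSucc, Fin.val_succ, Nat.lt_succ_iff]
  split_ifs <;> simp

lemma ins_Fbar {N : ℕ} {a b : Fin (N + 1)} (hab : a ≠ b)
    (t : Fin N ≃ {x : Fin (N + 1) // x ≠ b}) : Fbar a b (ins hab t) := by
  unfold Fbar
  rw [ins_symm_b, ins_symm_ne hab t a hab]
  simp

lemma ins_inj {N : ℕ} {a b : Fin (N + 1)} (hab : a ≠ b) :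
    Function.Injective (ins hab (N := N)) := by
  intro t t' h
  have hb : t.symm ⟨a, hab⟩ = t'.symm ⟨a, hab⟩ := by
    have := congrArg (fun e : Equiv.Perm (Fin (N + 1)) => e.symm b) h
    simpa [ins_symm_b] using this
  have : t.symm = t'.symm := by
    ext x
    have h1 := ins_symm_ne hab t x.1 x.2
    have h2 := ins_symm_ne hab t' x.1 x.2
    rw [h, h2, hb] at h1
    simp only [Subtype.coe_eta] at h1
    split_ifs at h1 <;> omega
  simpa using congrArg Equiv.symm this

lemma ins_surj {N : ℕ} {a b : Fin (N + 1)} (hab : a ≠ b) (σ : Equiv.Perm (Fin (N + 1)))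
    (hσ : Fbar a b σ) : ∃ t, ins hab t = σ := by
  let e : Option (Fin N) ≃ Option {x : Fin (N + 1) // x ≠ b} :=
    ((finSuccEquiv' (σ.symm b)).symm.trans σ).trans (Equiv.optionSubtypeNe b).symm
  have he : e none = none := by simp [e]
  have hoc : Equiv.optionCongr (Equiv.removeNone e) = e := by
    ext1 x
    cases x with
    | none => simp [he]
    | some x =>
      have : e (some x) ≠ none := by
        rw [← he]; intro h; simpa using e.injective h
      simp only [Equiv.optionCongr_apply, Option.map_some]
      exact Equiv.removeNone_some e (Option.ne_none_iff_exists'.mp this)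
  have hp : ((Equiv.removeNone e).symm ⟨a, hab⟩).succ = σ.symm b := by
    have h1 : e.symm (some ⟨a, hab⟩) = some ((Equiv.removeNone e).symm ⟨a, hab⟩) := by
      conv_lhs => rw [← hoc]
      rw [← Equiv.optionCongr_symm]
      rfl
    have h2 : σ.symm a = (σ.symm b).succAbove ((Equiv.removeNone e).symm ⟨a, hab⟩) := by
      have h3 := congrArg (finSuccEquiv' (σ.symm b)).symm h1
      simpa [e] using h3
    unfold Fbar at hσ
    have h4 := congrArg Fin.val h2
    rw [Fin.succAbove] at h4
    simp only [Fin.lt_def] at h4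
    ext
    split_ifs at h4 with h5
    · simp at h4 ⊢; omega
    · simp at h4 h5; omega
  refine ⟨Equiv.removeNone e, ?_⟩
  unfold ins
  rw [hp, hoc]
  ext x
  simp only [e, Equiv.trans_apply, Equiv.symm_apply_apply, Equiv.apply_symm_apply]

lemma swap_val {k : ℕ} (p q x : Fin k) : ((Equiv.swap p q x : Fin k) : ℕ) =
    if (x : ℕ) = p then (q : ℕ) else if (x : ℕ) = q then (p : ℕ) else x := by
  rw [Equiv.swap_apply_def]
  simp only [Fin.ext_iff]
  split_ifs <;> rfl

lemma perm_eq_of {k : ℕ} (σ π w : Equiv.Perm (Fin k))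
    (h : ∀ x, ((π.symm x : Fin k) : ℕ) = (w⁻¹ (σ.symm x) : Fin k)) : π = σ * w := by
  have : π⁻¹ = w⁻¹ * σ⁻¹ := by
    ext x; exact h x
  rw [← inv_inj, this, mul_inv_rev]

set_option maxHeartbeats 2000000 in
lemma ins_GAdj {N : ℕ} {a b : Fin (N + 1)} (hab : a ≠ b)
    (t : Fin N ≃ {x : Fin (N + 1) // x ≠ b}) (i j : Fin N) (hij : (i : ℕ) + 1 = (j : ℕ)) :
    GAdj a b (ins hab t) (ins hab ((Equiv.swap i j).trans t)) := by
  refine ⟨ins_Fbar _ _, ins_Fbar _ _, ?_⟩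
  have hjN := j.2
  set σ := ins hab t with hσ
  set π := ins hab ((Equiv.swap i j).trans t) with hπ
  have sb : ((σ.symm b : Fin (N + 1)) : ℕ) = (t.symm ⟨a, hab⟩ : ℕ) + 1 := by
    rw [hσ, ins_symm_b]; simp
  have sx := ins_symm_ne hab t
  rw [← hσ] at sx
  have pb : ((π.symm b : Fin (N + 1)) : ℕ) =
      (Equiv.swap i j (t.symm ⟨a, hab⟩) : Fin N) + 1 := by
    rw [hπ, ins_symm_b]; simp
  have px := ins_symm_ne hab ((Equiv.swap i j).trans t)
  rw [← hπ] at px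
  simp only [Equiv.symm_trans_apply, Equiv.symm_swap] at px
  simp only [swap_val] at pb px
  have inj : ∀ x (hx : x ≠ b), x ≠ a → (t.symm ⟨x, hx⟩ : ℕ) ≠ (t.symm ⟨a, hab⟩ : ℕ) := by
    intro x hx hxa h
    have := t.symm.injective (Fin.ext h)
    simp at this
    exact hxa this
  have sa := sx a hab
  rw [if_pos le_rfl] at sa
  set P : ℕ := (t.symm ⟨a, hab⟩ : ℕ) with hP
  have hval : ∀ (p : Fin (N + 1)) (y : Fin (N + 1)),
      ((σ.symm y : Fin (N+1)) : ℕ) = (p : ℕ) → σ p = y := by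
    intro p y h
    rw [← Fin.ext h]; simp
  have hval' : ∀ (p : Fin (N + 1)) (y : Fin (N + 1)),
      ((σ.symm y : Fin (N+1)) : ℕ) ≠ (p : ℕ) → σ p ≠ y := by
    intro p y h h'
    apply h; rw [← h']; simp
  by_cases c1 : P = i
  · right; right
    refine ⟨⟨i, by omega⟩, ⟨i + 1, by omega⟩, ⟨i + 2, by omega⟩, rfl, rfl,
      hval _ _ (by simp; omega), hval _ _ (by simp; omega), ?_⟩
    apply perm_eq_of
    intro x
    simp only [mul_inv_rev, Equiv.swap_inv, Equiv.Perm.mul_apply, swap_val]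
    by_cases hx : x = b
    · subst hx
      rw [pb, sb]; grind
    · rw [px x hx, sx x hx]
      by_cases hxa : x = a
      · subst hxa; grind
      · have := inj x hx hxa
        grind
  by_cases c2 : P = j
  · right; left
    refine ⟨⟨i, by omega⟩, ⟨i + 1, by omega⟩, ⟨i + 2, by omega⟩, rfl, rfl,
      hval _ _ (by simp; omega), hval _ _ (by simp; omega), ?_⟩
    apply perm_eq_of
    intro x
    simp only [mul_inv_rev, Equiv.swap_inv, Equiv.Perm.mul_apply, swap_val]
    by_cases hx : x = b
    · subst hx
      rw [pb, sb]; grind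
    · rw [px x hx, sx x hx]
      by_cases hxa : x = a
      · subst hxa; grind
      · have := inj x hx hxa
        grind
  · left
    have hform : ∃ p q : Fin (N + 1), (p : ℕ) + 1 = q ∧
        (p : ℕ) = if (i : ℕ) ≤ P then (i : ℕ) else i + 1 := by
      by_cases h : (i : ℕ) ≤ P
      · exact ⟨⟨i, by omega⟩, ⟨i + 1, by omega⟩, rfl, by simp [h]⟩
      · exact ⟨⟨i + 1, by omega⟩, ⟨i + 2, by omega⟩, rfl, by simp [h]⟩
    obtain ⟨p, q, hpq, hp⟩ := hform
    refine ⟨p, q, hpq, hval' _ _ ?_, hval' _ _ ?_, hval' _ _ ?_, hval' _ _ ?_, ?_⟩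
    · split_ifs at hp <;> omega
    · split_ifs at hp <;> omega
    · split_ifs at hp <;> omega
    · split_ifs at hp <;> omega
    apply perm_eq_of
    intro x
    simp only [Equiv.swap_inv, swap_val]
    by_cases hx : x = b
    · subst hx
      rw [pb, sb]; grind
    · rw [px x hx, sx x hx]
      by_cases hxa : x = a
      · subst hxa; grind
      · have := inj x hx hxa
        grind

lemma BSet_Fbar {k : ℕ} {f : Equiv.Perm (Fin k) → Fin k} {a b : Fin k} (hab : a ≠ b)
    {σ : Equiv.Perm (Fin k)} (h : BSet f a b σ) : Fbar a b σ := by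
  obtain ⟨h1, h2, h3⟩ := h
  unfold adjSwap at h2
  unfold Above at h3
  rw [Fin.lt_def] at h3
  split_ifs at h2 with h4
  · unfold Fbar; omega
  · exact absurd (h1.symm.trans h2) hab

lemma arith_final (ε n x u v w : ℝ) (hN : 2 ≤ n) (hX' : 0 < x) (hu : 0 ≤ u) (hw : 0 ≤ w)
    (hexp' : u * v ≤ x * (n * (2 * n * w))) (hc' : u + v = x)
    (h : u ≤ (1 - ε / (4 * (n + 1))) * x) : ε / (2 * (n + 1) ^ 4) * u ≤ w := by
  have hv : ε / (4 * (n + 1)) * x ≤ v := by linarith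
  have h5 : ε / (4 * (n + 1)) * u ≤ 2 * n ^ 2 * w := by
    have h6 := mul_le_mul_of_nonneg_left hv hu
    have h7 : x * (ε / (4 * (n + 1)) * u) ≤ x * (2 * n ^ 2 * w) := by nlinarith
    exact le_of_mul_le_mul_left h7 hX'
  have hn1 : 0 < n + 1 := by linarith
  have e : ε / (2 * (n + 1) ^ 4) * u = (ε / (4 * (n + 1)) * u) * (2 / (n + 1) ^ 3) := by
    field_simp; ring
  rw [e]
  have h8 : 2 * n ^ 2 * (2 / (n + 1) ^ 3) ≤ 1 := by
    rw [← mul_div_assoc, div_le_one (by positivity)]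
    nlinarith [mul_nonneg (sq_nonneg (n - 1)) hn1.le, sq_nonneg (n - 1)]
  calc _ ≤ (2 * n ^ 2 * w) * (2 / (n + 1) ^ 3) :=
        mul_le_mul_of_nonneg_right h5 (by positivity)
    _ = (2 * n ^ 2 * (2 / (n + 1) ^ 3)) * w := by ring
    _ ≤ 1 * w := mul_le_mul_of_nonneg_right h8 hw
    _ = w := one_mul w

end Helpers

theorem stmt12 (k : ℕ) (hk : 3 ≤ k) (ε : ℝ) (hε0 : 0 < ε) (hε1 : ε ≤ 1)
    (a b : Fin k) (hab : a ≠ b) (f : Equiv.Perm (Fin k) → Fin k)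
    (h : prob (fun σ : Equiv.Perm (Fin k) => BSet f a b σ ∧ Fbar a b σ) /
          prob (fun σ : Equiv.Perm (Fin k) => Fbar a b σ) ≤ 1 - ε / (4 * (k : ℝ))) :
    (ε / (2 * (k : ℝ) ^ 4)) * prob (fun σ : Equiv.Perm (Fin k) => BSet f a b σ) ≤
      prob (fun σ : Equiv.Perm (Fin k) => InBdryB f a b σ) := by
  classical
  obtain ⟨N, rfl⟩ : ∃ N, k = N + 1 := ⟨k - 1, by omega⟩
  let A : Finset (Fin N ≃ {x : Fin (N + 1) // x ≠ b}) :=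
    Finset.univ.filter (fun t => BSet f a b (ins hab t))
  set dA := A.filter (fun x => ∃ i j : Fin N, (i : ℕ) + 1 = (j : ℕ) ∧
        (Equiv.swap i j).trans x ∉ A) with hdA
  have hexp := expansion A
  rw [← hdA] at hexp
  have hF : (Finset.univ.filter (fun σ : Equiv.Perm (Fin (N + 1)) => Fbar a b σ)).card =
      Fintype.card (Fin N ≃ {x : Fin (N + 1) // x ≠ b}) := by
    rw [← Finset.card_univ, ← Finset.card_image_of_injective _ (ins_inj hab)]
    congr 1
    ext σ
    simp only [Finset.mem_filter, Finset.mem_univ, true_and, Finset.mem_image]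
    exact ⟨ins_surj hab σ, fun ⟨t, ht⟩ => ht ▸ ins_Fbar hab t⟩
  have hB : (Finset.univ.filter (fun σ : Equiv.Perm (Fin (N + 1)) => BSet f a b σ)).card =
      A.card := by
    rw [← Finset.card_image_of_injective A (ins_inj hab)]
    congr 1
    ext σ
    simp only [A, Finset.mem_filter, Finset.mem_univ, true_and, Finset.mem_image]
    constructor
    · intro h
      obtain ⟨t, rfl⟩ := ins_surj hab σ (BSet_Fbar hab h)
      exact ⟨t, h, rfl⟩
    · rintro ⟨t, h, rfl⟩; exact h
  have hD : dA.card ≤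
      (Finset.univ.filter (fun σ : Equiv.Perm (Fin (N + 1)) => InBdryB f a b σ)).card := by
    rw [← Finset.card_image_of_injective dA (ins_inj hab)]
    apply Finset.card_le_card
    intro σ
    simp only [hdA, A, Finset.mem_filter, Finset.mem_univ, true_and, Finset.mem_image]
    rintro ⟨t, ⟨h1, i, j, hij, h2⟩, rfl⟩
    exact ⟨h1, _, ins_GAdj hab t i j hij, h2⟩
  have hBF : (fun σ : Equiv.Perm (Fin (N + 1)) => BSet f a b σ ∧ Fbar a b σ) =
      fun σ => BSet f a b σ := by
    funext σ
    exact propext ⟨fun h => h.1, fun h => ⟨h, BSet_Fbar hab h⟩⟩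
  rw [hBF] at h
  have pB : prob (fun σ : Equiv.Perm (Fin (N + 1)) => BSet f a b σ) =
      (A.card : ℝ) / (Fintype.card (Equiv.Perm (Fin (N + 1))) : ℝ) := by
    rw [← hB]; unfold prob; congr!
  have pF : prob (fun σ : Equiv.Perm (Fin (N + 1)) => Fbar a b σ) =
      (Fintype.card (Fin N ≃ {x : Fin (N + 1) // x ≠ b}) : ℝ) /
        (Fintype.card (Equiv.Perm (Fin (N + 1))) : ℝ) := by
    rw [← hF]; unfold prob; congr!
  have pD : (dA.card : ℝ) / (Fintype.card (Equiv.Perm (Fin (N + 1))) : ℝ) ≤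
      prob (fun σ : Equiv.Perm (Fin (N + 1)) => InBdryB f a b σ) := by
    refine (div_le_div_of_nonneg_right (Nat.cast_le.mpr hD) (Nat.cast_nonneg _)).trans
      (le_of_eq ?_)
    unfold prob; congr!
  refine le_trans ?_ pD
  rw [pB, pF] at h
  rw [pB]
  have hG : Fintype.card (Equiv.Perm (Fin N)) =
      Fintype.card (Fin N ≃ {x : Fin (N + 1) // x ≠ b}) :=
    Fintype.card_congr (Equiv.equivCongr (Equiv.refl _) (finSuccAboveEquiv b))
  have hXpos : 0 < Fintype.card (Fin N ≃ {x : Fin (N + 1) // x ≠ b}) := by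
    rw [← hG]; exact Fintype.card_pos
  have hcompl : A.card + Aᶜ.card = Fintype.card (Fin N ≃ {x : Fin (N + 1) // x ≠ b}) :=
    Finset.card_add_card_compl A
  rw [hG] at hexp
  have hTpos : (0 : ℝ) < (Fintype.card (Equiv.Perm (Fin (N + 1))) : ℝ) :=
    Nat.cast_pos.mpr Fintype.card_pos
  generalize (Fintype.card (Equiv.Perm (Fin (N + 1))) : ℝ) = T at h hTpos ⊢
  generalize Fintype.card (Fin N ≃ {x : Fin (N + 1) // x ≠ b}) = X at h hexp hcompl hXpos
  rw [div_div_div_cancel_right₀ hTpos.ne'] at h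
  rw [← mul_div_assoc]
  refine div_le_div_of_nonneg_right ?_ hTpos.le
  have hX' : (0 : ℝ) < X := Nat.cast_pos.mpr hXpos
  rw [div_le_iff₀ hX'] at h
  have hexp' : (A.card : ℝ) * (Aᶜ.card : ℝ) ≤ X * (N * (2 * N * dA.card)) := by
    exact_mod_cast hexp
  have hc' : (A.card : ℝ) + (Aᶜ.card : ℝ) = X := by exact_mod_cast hcompl
  have hN : (2 : ℝ) ≤ N := by
    have : 2 ≤ N := by omega
    exact_mod_cast this
  have hu : (0 : ℝ) ≤ A.card := Nat.cast_nonneg _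
  have hw : (0 : ℝ) ≤ dA.card := Nat.cast_nonneg _
  push_cast at h ⊢
  exact arith_final ε N X _ _ _ hN hX' hu hw hexp' hc' h
end
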